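/- Let Ω ⊂ ℝ² be a bounded connected open set and let 1 < p < ∞. Let σ₁, σ₂ : closure(Ω) → ℝ be Lipschitz continuous with σⱼ ≥ c₀ > 0, let A : closure(Ω) → (2×2 real matrices) be Lipschitz continuous with A(x) symmetric and A(x)ξ·ξ ≥ c₀|ξ|² for all x ∈ Ω, ξ ∈ ℝ², and assume σ₁ ≥ σ₂ on Ω. Suppose there exist a non-constant u₂ ∈ C¹(closure Ω) which is a weak solution of div(σ₂|A∇u₂·∇u₂|^{(p−2)/2}A∇u₂) = 0 in Ω, and u₁ ∈ C¹(closure Ω) which is a weak solution of div(σ₁|A∇u₁·∇u₁|^{(p−2)/2}A∇u₁) = 0 in Ω with u₁ = u₂ on ∂Ω and with equal energies E_{σ₁,A}(u₁) = E_{σ₂,A}(u₂) (which holds when the nonlinear Dirichlet-to-Neumann maps of σ₁ and σ₂ coincide). Then σ₁ = σ₂ in Ω. -/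

import Mathlib

open MeasureTheory Real
open scoped RealInnerProductSpace

/-- The linear action of an `n × n` real matrix on Euclidean space, as a
continuous linear map. -/
noncomputable def matCLM {n : ℕ} (M : Matrix (Fin n) (Fin n) ℝ) :
    EuclideanSpace ℝ (Fin n) →L[ℝ] EuclideanSpace ℝ (Fin n) :=
  LinearMap.toContinuousLinearMap (Matrix.toEuclideanLin M)

/-- `u` is a weak solution of `div(σ |A∇u·∇u|^((p-2)/2) A∇u) = 0` in `Ω`,
tested against `C¹(closure Ω)` functions vanishing on `∂Ω`. -/
def IsWeakSolution {n : ℕ} (Ω : Set (EuclideanSpace ℝ (Fin n))) (p : ℝ)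
    (σ : EuclideanSpace ℝ (Fin n) → ℝ)
    (A : EuclideanSpace ℝ (Fin n) → Matrix (Fin n) (Fin n) ℝ)
    (u : EuclideanSpace ℝ (Fin n) → ℝ) : Prop :=
  ∀ φ : EuclideanSpace ℝ (Fin n) → ℝ, ContDiffOn ℝ 1 φ (closure Ω) →
    (∀ x ∈ frontier Ω, φ x = 0) →
    ∫ x in Ω, σ x * |⟪matCLM (A x) (gradient u x), gradient u x⟫| ^ ((p - 2) / 2)
      * ⟪matCLM (A x) (gradient u x), gradient φ x⟫ = 0

/-- The `p`-Dirichlet energy `E_{σ,A}(v) = ∫_Ω σ |A∇v·∇v|^(p/2) dx`. -/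
noncomputable def energy {n : ℕ} (Ω : Set (EuclideanSpace ℝ (Fin n))) (p : ℝ)
    (σ : EuclideanSpace ℝ (Fin n) → ℝ)
    (A : EuclideanSpace ℝ (Fin n) → Matrix (Fin n) (Fin n) ℝ)
    (v : EuclideanSpace ℝ (Fin n) → ℝ) : ℝ :=
  ∫ x in Ω, σ x * |⟪matCLM (A x) (gradient v x), gradient v x⟫| ^ (p / 2)

/-- The Euclidean plane. -/
abbrev Plane := EuclideanSpace ℝ (Fin 2)

/-- The exterior product of two covectors of the plane, in standard coordinates. -/
noncomputable def wedge (L M : Plane →L[ℝ] ℝ) : ℝ :=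
  L (EuclideanSpace.single 0 1) * M (EuclideanSpace.single 1 1) -
    L (EuclideanSpace.single 1 1) * M (EuclideanSpace.single 0 1)

lemma wedge_smul_left (c : ℝ) (L M : Plane →L[ℝ] ℝ) : wedge (c • L) M = c * wedge L M := by
  simp only [wedge, smul_apply, smul_eq_mul]; ring

lemma abs_wedge_le (L M : Plane →L[ℝ] ℝ) : |wedge L M| ≤ 2 * ‖L‖ * ‖M‖ := by
  have hb : ∀ (N : Plane →L[ℝ] ℝ) (i : Fin 2), |N (EuclideanSpace.single i 1)| ≤ ‖N‖ := by
    intro N i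
    simpa using N.le_opNorm (EuclideanSpace.single i (1 : ℝ))
  have h1 := mul_le_mul (hb L 0) (hb M 1) (abs_nonneg _) (norm_nonneg _)
  have h2 := mul_le_mul (hb L 1) (hb M 0) (abs_nonneg _) (norm_nonneg _)
  rw [← abs_mul] at h1 h2
  calc |wedge L M| ≤ _ := abs_sub _ _
    _ ≤ 2 * ‖L‖ * ‖M‖ := by linarith

lemma continuous_wedge : Continuous fun P : (Plane →L[ℝ] ℝ) × (Plane →L[ℝ] ℝ) => wedge P.1 P.2 := by
  unfold wedge; fun_prop

lemma integral_wedge_fderiv_eq_zero_of_contDiff_two {φ w : Plane → ℝ} (hφ : ContDiff ℝ 2 φ)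
    (hφc : HasCompactSupport φ) (hw : ContDiff ℝ 1 w) :
    ∫ x, wedge (fderiv ℝ φ x) (fderiv ℝ w x) = 0 := by
  have hφ' : ContDiff ℝ 1 (fderiv ℝ φ) := hφ.fderiv_right (by norm_num)
  have hwc : Continuous (fderiv ℝ w) := hw.continuous_fderiv one_ne_zero
  have hφ'd : ∀ e : Plane, ContDiff ℝ 1 (fun x => fderiv ℝ φ x e) := fun e =>
    hφ'.clm_apply contDiff_const
  have hφ's : ∀ e : Plane, HasCompactSupport (fun x => fderiv ℝ φ x e) := fun e =>
    hφc.fderiv_apply ℝ e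
  have hI1 : ∀ e e' : Plane, Integrable (fun x => fderiv ℝ φ x e * fderiv ℝ w x e') := by
    intro e e'
    refine Continuous.integrable_of_hasCompactSupport ?_ (hφ's e).mul_right
    exact (hφ'd e).continuous.mul (by fun_prop)
  have hfd : ∀ e e' x, fderiv ℝ (fun x => fderiv ℝ φ x e) x e' = fderiv ℝ (fderiv ℝ φ) x e' e := by
    intro e e' x
    rw [fderiv_clm_apply ((hφ'.differentiable one_ne_zero) x) (by fun_prop)]
    simp
  have hIbp : ∀ e e' : Plane, ∫ x, fderiv ℝ φ x e * fderiv ℝ w x e' =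
      - ∫ x, fderiv ℝ (fderiv ℝ φ) x e' e * w x := by
    intro e e'
    rw [integral_mul_fderiv_eq_neg_fderiv_mul_of_integrable]
    · simp only [hfd]
    · refine Continuous.integrable_of_hasCompactSupport ?_ ((hφ's e).fderiv_apply ℝ e').mul_right
      exact (((hφ'd e).continuous_fderiv one_ne_zero).clm_apply continuous_const).mul hw.continuous
    · exact hI1 e e'
    · exact Continuous.integrable_of_hasCompactSupport ((hφ'd e).continuous.mul hw.continuous)
        (hφ's e).mul_right
    · exact fun x _ => (hφ'd e).differentiable one_ne_zero x
    · exact fun x _ => hw.differentiable one_ne_zero x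
  unfold wedge
  rw [integral_sub (hI1 _ _) (hI1 _ _), hIbp, hIbp]
  have hsymm : ∀ x (e e' : Plane), fderiv ℝ (fderiv ℝ φ) x e' e = fderiv ℝ (fderiv ℝ φ) x e e' := by
    intro x e e'
    exact (hφ.contDiffAt.isSymmSndFDerivAt (by simp)) e' e
  simp only [hsymm _ (EuclideanSpace.single 0 1) (EuclideanSpace.single 1 1), sub_self]

/-- A sequence of bump functions centred at the origin with shrinking supports. -/
noncomputable def shrinkingBump (n : ℕ) : ContDiffBump (0 : Plane) where
  rIn := 1 / (2 * ((n : ℝ) + 1))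
  rOut := 1 / ((n : ℝ) + 1)
  rIn_pos := by positivity
  rIn_lt_rOut := by
    apply one_div_lt_one_div_of_lt
    · positivity
    · have : (0 : ℝ) ≤ n := n.cast_nonneg
      linarith

lemma tendsto_shrinkingBump_rOut :
    Filter.Tendsto (fun n => (shrinkingBump n).rOut) Filter.atTop (nhds 0) :=
  tendsto_one_div_add_atTop_nhds_zero_nat

lemma integral_wedge_fderiv_eq_zero {φ w : Plane → ℝ} (hφ : ContDiff ℝ 1 φ)
    (hφc : HasCompactSupport φ) (hw : ContDiff ℝ 1 w) :
    ∫ x, wedge (fderiv ℝ φ x) (fderiv ℝ w x) = 0 := by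
  let L := ContinuousLinearMap.lsmul ℝ ℝ (E := ℝ)
  let ρ : ℕ → Plane → ℝ := fun n => (shrinkingBump n).normed volume
  let Φ : ℕ → Plane → ℝ := fun n => convolution (ρ n) φ L volume
  have hρc : ∀ n, HasCompactSupport (ρ n) := fun n => (shrinkingBump n).hasCompactSupport_normed
  have hρs : ∀ n, ContDiff ℝ 2 (ρ n) := fun n => (shrinkingBump n).contDiff_normed
  have hρi : ∀ n, LocallyIntegrable (ρ n) volume := fun n => (hρs n).continuous.locallyIntegrable
  have hΦ2 : ∀ n, ContDiff ℝ 2 (Φ n) := fun n =>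
    (hρc n).contDiff_convolution_left L (hρs n) hφ.continuous.locallyIntegrable
  have hΦc : ∀ n, HasCompactSupport (Φ n) := fun n => (hρc n).convolution L hφc
  have hcφ' : Continuous (fderiv ℝ φ) := hφ.continuous_fderiv one_ne_zero
  have hcw' : Continuous (fderiv ℝ w) := hw.continuous_fderiv one_ne_zero
  have hΦ' : ∀ n x, fderiv ℝ (Φ n) x =
      convolution (ρ n) (fderiv ℝ φ) (ContinuousLinearMap.lsmul ℝ ℝ) volume x := by
    intro n x
    rw [(hφc.hasFDerivAt_convolution_right L (hρi n) hφ x).fderiv]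
    rfl
  obtain ⟨M, hM⟩ := (hφc.fderiv ℝ).exists_bound_of_continuous hcφ'
  have hM0 : 0 ≤ M := (norm_nonneg _).trans (hM 0)
  have hbound : ∀ n x, ‖fderiv ℝ (Φ n) x‖ ≤ 3 * M := by
    intro n x
    rw [hΦ']
    have h := (shrinkingBump n).dist_normed_convolution_le (μ := volume) (g := fderiv ℝ φ)
      (x₀ := x) (ε := 2 * M) hcφ'.aestronglyMeasurable (by
        intro y _
        rw [dist_eq_norm]
        linarith [norm_sub_le (fderiv ℝ φ y) (fderiv ℝ φ x), hM y, hM x])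
    rw [dist_eq_norm] at h
    have := norm_le_norm_add_norm_sub' (convolution (ρ n) (fderiv ℝ φ)
      (ContinuousLinearMap.lsmul ℝ ℝ) volume x) (fderiv ℝ φ x)
    linarith [hM x]
  have hlim : ∀ x, Filter.Tendsto (fun n => fderiv ℝ (Φ n) x) Filter.atTop
      (nhds (fderiv ℝ φ x)) := by
    intro x
    simp only [hΦ']
    exact ContDiffBump.convolution_tendsto_right_of_continuous tendsto_shrinkingBump_rOut hcφ' x
  set K : Set Plane := Metric.cthickening 1 (tsupport φ) with hK
  have hKc : IsCompact K := hφc.isCompact.cthickening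
  have hsupp : ∀ n x, x ∉ K → fderiv ℝ (Φ n) x = 0 := by
    intro n x hx
    rw [hΦ']
    refine Function.notMem_support.mp fun hx' => hx ?_
    have h1 := support_convolution_subset_swap (ContinuousLinearMap.lsmul ℝ ℝ) hx'
    obtain ⟨y, hy, z, hz, rfl⟩ := h1
    have hy1 : y ∈ tsupport φ := support_fderiv_subset ℝ hy
    have hz1 : z ∈ Metric.ball (0 : Plane) (shrinkingBump n).rOut := by
      rw [← (shrinkingBump n).support_normed_eq (μ := volume)]; exact hz
    refine Metric.mem_cthickening_of_dist_le _ y 1 _ hy1 ?_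
    have h2 : (shrinkingBump n).rOut ≤ 1 := by
      change 1 / ((n : ℝ) + 1) ≤ 1
      rw [div_le_one (by positivity)]
      have : (0 : ℝ) ≤ n := n.cast_nonneg
      linarith
    rw [mem_ball_zero_iff] at hz1
    simp only [dist_eq_norm, add_sub_cancel_left]
    linarith
  obtain ⟨W, hW⟩ := hKc.exists_bound_of_continuousOn hcw'.continuousOn
  have hconv : Filter.Tendsto (fun n => ∫ x, wedge (fderiv ℝ (Φ n) x) (fderiv ℝ w x))
      Filter.atTop (nhds (∫ x, wedge (fderiv ℝ φ x) (fderiv ℝ w x))) := by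
    refine tendsto_integral_of_dominated_convergence
      (K.indicator fun _ => 2 * (3 * M) * W) ?_ ?_ ?_ ?_
    · intro n
      have : Continuous (fderiv ℝ (Φ n)) := (hΦ2 n).continuous_fderiv two_ne_zero
      exact (continuous_wedge.comp (this.prodMk hcw')).aestronglyMeasurable
    · rw [integrable_indicator_iff hKc.measurableSet]
      exact integrableOn_const hKc.measure_lt_top.ne
    · intro n
      refine Filter.Eventually.of_forall fun x => ?_
      by_cases hx : x ∈ K
      · rw [Set.indicator_of_mem hx, Real.norm_eq_abs]
        refine (abs_wedge_le _ _).trans ?_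
        have := hbound n x
        have := hW x hx
        gcongr
      · simp [Set.indicator_of_notMem hx, hsupp n x hx, wedge]
    · refine Filter.Eventually.of_forall fun x => ?_
      exact (continuous_wedge.tendsto _).comp ((hlim x).prodMk_nhds tendsto_const_nhds)
  simp only [integral_wedge_fderiv_eq_zero_of_contDiff_two (hΦ2 _) (hΦc _) hw] at hconv
  exact (tendsto_nhds_unique hconv tendsto_const_nhds)

lemma symmetric_of_apply_single {B : Plane →L[ℝ] Plane →L[ℝ] ℝ}
    (h : B (EuclideanSpace.single 0 1) (EuclideanSpace.single 1 1) =
      B (EuclideanSpace.single 1 1) (EuclideanSpace.single 0 1)) (x y : Plane) :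
    B x y = B y x := by
  have hx : ∀ z : Plane, z = z 0 • EuclideanSpace.single 0 1 + z 1 • EuclideanSpace.single 1 1 := by
    intro z
    ext i
    fin_cases i <;> simp
  rw [hx x, hx y]
  simp only [map_add, map_smul, add_apply, smul_apply, smul_eq_mul, h]
  ring

set_option maxSynthPendingDepth 3 in
/-- Derivative of a mollified one-form, evaluated on two vectors. -/
lemma fderiv_convolution_apply_apply {E : Type*} [NormedAddCommGroup E] [InnerProductSpace ℝ E]
    [FiniteDimensional ℝ E] [MeasurableSpace E] [BorelSpace E]
    {G : E → (E →L[ℝ] ℝ)} (hG : Continuous G)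
    {ρ : E → ℝ} (hρc : HasCompactSupport ρ) (hρs : ContDiff ℝ 1 ρ) (x e e' : E) :
    fderiv ℝ (convolution ρ G (ContinuousLinearMap.lsmul ℝ ℝ) volume) x e e' =
      ∫ t, fderiv ℝ ρ t e * G (x - t) e' := by
  let h : E → E →L[ℝ] E →L[ℝ] ℝ := fun t =>
    (ContinuousLinearMap.lsmul ℝ ℝ).precompL E (fderiv ℝ ρ t) (G (x - t))
  have hintegr : Integrable h volume := by
    have hh : Continuous h := by
      have := hρs.continuous_fderiv one_ne_zero
      fun_prop
    refine hh.integrable_of_hasCompactSupport ?_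
    exact (hρc.fderiv ℝ).mono fun t ht h0 => ht (by simp [h, h0])
  rw [(hρc.hasFDerivAt_convolution_left _ hρs hG.locallyIntegrable x).fderiv, convolution,
    ContinuousLinearMap.integral_apply hintegr, ContinuousLinearMap.integral_apply
      (hintegr.apply_continuousLinearMap e)]
  rfl

/-- Mollifying a weakly closed one-form gives a closed one-form. -/
lemma fderiv_convolution_symmetric {G : Plane → (Plane →L[ℝ] ℝ)} (hG : Continuous G)
    {x x₀ : Plane} {R : ℝ}
    (hcl : ∀ φ : Plane → ℝ, ContDiff ℝ 1 φ → tsupport φ ⊆ Metric.ball x₀ R →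
      ∫ x, wedge (fderiv ℝ φ x) (G x) = 0)
    (b : ContDiffBump (0 : Plane)) (hx : dist x x₀ + b.rOut < R) (y z : Plane) :
    fderiv ℝ (convolution (b.normed volume) G (ContinuousLinearMap.lsmul ℝ ℝ) volume) x y z =
      fderiv ℝ (convolution (b.normed volume) G (ContinuousLinearMap.lsmul ℝ ℝ) volume) x z y := by
  have hρc : HasCompactSupport (b.normed volume) := b.hasCompactSupport_normed
  have hρs : ContDiff ℝ 1 (b.normed volume) := b.contDiff_normed
  refine symmetric_of_apply_single ?_ y z
  let φ : Plane → ℝ := fun y => b.normed volume (x - y)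
  have hφ : ContDiff ℝ 1 φ := hρs.comp (contDiff_const.sub contDiff_id)
  have hφs : tsupport φ ⊆ Metric.ball x₀ R := by
    refine (closure_minimal (s := Function.support φ) (t := Metric.closedBall x b.rOut) ?_
      Metric.isClosed_closedBall).trans ?_
    · intro y hy
      have : x - y ∈ Function.support (b.normed volume) := hy
      rw [b.support_normed_eq, mem_ball_zero_iff] at this
      rw [Metric.mem_closedBall, dist_comm, dist_eq_norm]
      exact this.le
    · exact Metric.closedBall_subset_ball' (by linarith)
  have hφ' : ∀ y e, fderiv ℝ φ y e = - fderiv ℝ (b.normed volume) (x - y) e := by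
    intro y e
    have h1 : HasFDerivAt (fun y : Plane => x - y) (-ContinuousLinearMap.id ℝ Plane) y :=
      (hasFDerivAt_id y).const_sub x
    have h2 := ((hρs.differentiable one_ne_zero) (x - y)).hasFDerivAt.comp y h1
    have h3 : fderiv ℝ φ y = _ := h2.fderiv
    rw [h3]; simp
  have h0 := hcl φ hφ hφs
  have hintegr : ∀ e e' : Plane,
      Integrable fun t => fderiv ℝ (b.normed volume) t e * G (x - t) e' := by
    intro e e'
    refine Continuous.integrable_of_hasCompactSupport ?_ (hρc.fderiv_apply ℝ e).mul_right
    have := hρs.continuous_fderiv one_ne_zero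
    fun_prop
  rw [fderiv_convolution_apply_apply hG hρc hρs, fderiv_convolution_apply_apply hG hρc hρs,
    ← sub_eq_zero, ← integral_sub (hintegr _ _) (hintegr _ _)]
  rw [← integral_sub_left_eq_self _ _ x] at h0
  rw [← neg_eq_zero, ← integral_neg, ← h0]
  congr 1 with t
  simp only [wedge, hφ', sub_sub_cancel]
  ring

/-- A continuous one-form on the plane that is weakly closed on a ball has a primitive on the
concentric ball of half the radius. -/
lemma exists_primitive_of_weakly_closed {G : Plane → (Plane →L[ℝ] ℝ)} (hG : Continuous G)
    (hGc : HasCompactSupport G) {x₀ : Plane} {R : ℝ} (hR : 0 < R)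
    (hcl : ∀ φ : Plane → ℝ, ContDiff ℝ 1 φ → tsupport φ ⊆ Metric.ball x₀ R →
      ∫ x, wedge (fderiv ℝ φ x) (G x) = 0) :
    ∃ v : Plane → ℝ, ∀ x ∈ Metric.ball x₀ (R / 2), HasFDerivAt v (G x) x := by
  obtain ⟨N, hN⟩ : ∃ N, ∀ n ≥ N, (shrinkingBump n).rOut < R / 2 := by
    have h := tendsto_shrinkingBump_rOut.eventually (gt_mem_nhds (half_pos hR))
    exact Filter.eventually_atTop.mp h
  let ρ : ℕ → Plane → ℝ := fun n => (shrinkingBump (n + N)).normed volume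
  let Γ : ℕ → Plane → (Plane →L[ℝ] ℝ) := fun n => convolution (ρ n) G (ContinuousLinearMap.lsmul ℝ ℝ) volume
  have hρc : ∀ n, HasCompactSupport (ρ n) := fun n =>
    (shrinkingBump (n + N)).hasCompactSupport_normed
  have hρs : ∀ n, ContDiff ℝ 1 (ρ n) := fun n => (shrinkingBump (n + N)).contDiff_normed
  have hsymm : ∀ n, ∀ x ∈ Metric.ball x₀ (R / 2), ∀ y z,
      fderiv ℝ (Γ n) x y z = fderiv ℝ (Γ n) x z y := fun n x hx =>
    fderiv_convolution_symmetric hG hcl (shrinkingBump (n + N)) (by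
      have := hN (n + N) (by omega)
      rw [Metric.mem_ball] at hx
      linarith)
  have hdiff : ∀ n, DifferentiableOn ℝ (Γ n) (Metric.ball x₀ (R / 2)) := fun n x _ =>
    ((hρc n).hasFDerivAt_convolution_left _ (hρs n) hG.locallyIntegrable
      x).differentiableAt.differentiableWithinAt
  choose f hf using fun n => (convex_ball x₀ (R / 2)).exists_forall_hasFDerivAt_of_fderiv_symmetric
    Metric.isOpen_ball (hdiff n) (hsymm n)
  let g : ℕ → Plane → ℝ := fun n x => f n x - f n x₀
  have hg : ∀ n, ∀ x ∈ Metric.ball x₀ (R / 2), HasFDerivAt (g n) (Γ n x) x := fun n x hx =>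
    (hf n x hx).sub_const _
  have huc : UniformContinuous G := hGc.uniformContinuous_of_continuous hG
  have hunif : TendstoUniformlyOn Γ G Filter.atTop (Metric.ball x₀ (R / 2)) := by
    rw [Metric.tendstoUniformlyOn_iff]
    intro ε hε
    obtain ⟨δ, hδ, hδG⟩ := Metric.uniformContinuous_iff.mp huc (ε / 2) (half_pos hε)
    have h := tendsto_shrinkingBump_rOut.eventually (gt_mem_nhds hδ)
    filter_upwards [(Filter.tendsto_add_atTop_nat N).eventually h] with n hn x _
    rw [dist_comm]
    refine lt_of_le_of_lt ((shrinkingBump (n + N)).dist_normed_convolution_le (μ := volume)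
      hG.aestronglyMeasurable (ε := ε / 2) ?_) (half_lt_self hε)
    intro y hy
    exact (hδG ((Metric.mem_ball.mp hy).trans hn)).le
  have hx₀ : x₀ ∈ Metric.ball x₀ (R / 2) := Metric.mem_ball_self (half_pos hR)
  have hcau : ∀ x ∈ Metric.ball x₀ (R / 2), CauchySeq fun n => g n x := by
    intro x hx
    refine cauchy_map_of_uniformCauchySeqOn_fderiv Metric.isOpen_ball
      (convex_ball x₀ (R / 2)).isPreconnected hunif.uniformCauchySeqOn hg hx₀ hx ?_
    have : (fun n => g n x₀) = fun _ => 0 := by ext n; simp [g]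
    rw [this]
    exact cauchySeq_const (0 : ℝ)
  choose! v hv using fun x hx => cauchySeq_tendsto_of_complete (hcau x hx)
  exact ⟨v, fun x hx => hasFDerivAt_of_tendstoUniformlyOn Metric.isOpen_ball hunif hg hv hx⟩

/-- The regularised gauge `|n s|^p + |n t|^q + e^{-n}`. -/
noncomputable def regGauge (p q s t : ℝ) (n : ℕ) : ℝ :=
  |n * s| ^ p + |n * t| ^ q + exp (-n)

/-- The weight `∑ 1 / D_n`, with `D_n` the regularised gauge. -/
noncomputable def gaugeSum (p q : ℝ) (T : ℕ) (s t : ℝ) : ℝ :=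
  ∑ n ∈ Finset.range (T + 1), (regGauge p q s t n)⁻¹

/-- The density `∑ e^{-n} / D_n ^ 2`. -/
noncomputable def gaugeDensity (p q : ℝ) (T : ℕ) (s t : ℝ) : ℝ :=
  ∑ n ∈ Finset.range (T + 1), exp (-n) * ((regGauge p q s t n) ^ 2)⁻¹

/-- The partial derivative of `regGauge p q s t n` in `s`. -/
noncomputable def gaugeSlope (p s : ℝ) (n : ℕ) : ℝ :=
  n * (p * |n * s| ^ (p - 2) * (n * s))

/-- The logarithmic potential `∑ e^{-n} / ((n + 1) D_n)`. -/
noncomputable def gaugePotential (p q : ℝ) (T : ℕ) (s t : ℝ) : ℝ :=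
  ∑ n ∈ Finset.range (T + 1), (1 / ((n : ℝ) + 1)) * exp (-n) * (regGauge p q s t n)⁻¹

lemma regGauge_pos (p q s t : ℝ) (n : ℕ) : 0 < regGauge p q s t n := by
  unfold regGauge; positivity

lemma exp_le_regGauge (p q s t : ℝ) (n : ℕ) : exp (-n) ≤ regGauge p q s t n := by
  have h1 : 0 ≤ |n * s| ^ p := by positivity
  have h2 : 0 ≤ |n * t| ^ q := by positivity
  unfold regGauge; linarith

lemma regGauge_comm (p q s t : ℝ) (n : ℕ) : regGauge p q s t n = regGauge q p t s n := by
  unfold regGauge; ring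

lemma gaugeSum_comm (p q : ℝ) (T : ℕ) (s t : ℝ) : gaugeSum p q T s t = gaugeSum q p T t s := by
  simp only [gaugeSum, regGauge_comm p q]

lemma gaugeDensity_comm (p q : ℝ) (T : ℕ) (s t : ℝ) :
    gaugeDensity p q T s t = gaugeDensity q p T t s := by
  simp only [gaugeDensity, regGauge_comm p q]

lemma gaugeDensity_nonneg (p q : ℝ) (T : ℕ) (s t : ℝ) : 0 ≤ gaugeDensity p q T s t :=
  Finset.sum_nonneg fun _ _ => by positivity

/-- Tail estimate for the sum of the powers `n ^ (-m)`, `m > 1`. -/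
lemma sum_Ico_rpow_neg_le {m : ℝ} (hm : 1 < m) {K : ℕ} (hK : 1 ≤ K) (T : ℕ) :
    ∑ n ∈ Finset.Ico (K + 1) (T + 1), (n : ℝ) ^ (-m) ≤ (K : ℝ) ^ (1 - m) / (m - 1) := by
  have hK0 : (0 : ℝ) < K := by exact_mod_cast hK
  rcases le_or_gt T K with h | h
  · rw [Finset.Ico_eq_empty (by omega), Finset.sum_empty]
    have : 0 < m - 1 := by linarith
    positivity
  have hanti : AntitoneOn (fun x : ℝ => x ^ (-m)) (Set.Icc (K : ℝ) (K + (T - K : ℕ))) := by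
    intro x hx y _ hxy
    exact rpow_le_rpow_of_nonpos (hK0.trans_le hx.1) hxy (by linarith)
  have h1 := hanti.sum_le_integral
  rw [integral_rpow (Or.inr ⟨by linarith, by
    rw [Set.uIcc_of_le (by simp)]
    exact fun h => absurd h.1 (not_le.mpr hK0)⟩)] at h1
  rw [Finset.sum_Ico_eq_sum_range]
  have h2 : T + 1 - (K + 1) = T - K := by omega
  rw [h2]
  refine le_trans (le_of_eq ?_) (h1.trans ?_)
  · refine Finset.sum_congr rfl fun i _ => ?_
    congr 1; push_cast; ring
  · have h3 : (0 : ℝ) ≤ (K + (T - K : ℕ) : ℝ) ^ (-m + 1) := by positivity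
    rw [show (1 : ℝ) - m = -m + 1 by ring, show m - 1 = -(-m + 1) by ring, div_neg, ← neg_div]
    exact div_le_div_of_nonpos_of_le (by linarith) (by linarith)

/-- A two-sided geometric sum is bounded independently of its centre and its length. -/
lemma sum_pow_dist_le {r : ℝ} (hr0 : 0 ≤ r) (hr1 : r < 1) (K T : ℕ) :
    ∑ n ∈ Finset.range T, r ^ ((n - K) + (K - n)) ≤ 2 / (1 - r) := by
  have hs : Summable fun n : ℕ => r ^ n := summable_geometric_of_lt_one hr0 hr1
  have hb : ∀ S : Finset ℕ, ∑ n ∈ S, r ^ n ≤ 1 / (1 - r) := by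
    intro S
    rw [one_div, ← tsum_geometric_of_lt_one hr0 hr1]
    exact hs.sum_le_tsum S fun n _ => by positivity
  rw [← Finset.sum_filter_add_sum_filter_not (Finset.range T) (fun n => K ≤ n)]
  have h1 : ∑ n ∈ Finset.range T with K ≤ n, r ^ ((n - K) + (K - n)) ≤ 1 / (1 - r) := by
    refine le_trans (le_of_eq ?_) (hb (((Finset.range T).filter (fun n => K ≤ n)).image (· - K)))
    rw [Finset.sum_image]
    · refine Finset.sum_congr rfl fun n hn => ?_
      have := (Finset.mem_filter.mp hn).2
      congr 1; omega
    · intro a ha b hb h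
      have := (Finset.mem_filter.mp ha).2
      have := (Finset.mem_filter.mp hb).2
      simp only at h
      omega
  have h2 : ∑ n ∈ Finset.range T with ¬ K ≤ n, r ^ ((n - K) + (K - n)) ≤ 1 / (1 - r) := by
    refine le_trans (le_of_eq ?_) (hb (((Finset.range T).filter (fun n => ¬ K ≤ n)).image (K - ·)))
    rw [Finset.sum_image]
    · refine Finset.sum_congr rfl fun n hn => ?_
      have := (Finset.mem_filter.mp hn).2
      congr 1; omega
    · intro a ha b hb h
      have := (Finset.mem_filter.mp ha).2
      have := (Finset.mem_filter.mp hb).2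
      simp only at h
      omega
  calc _ ≤ 1 / (1 - r) + 1 / (1 - r) := add_le_add h1 h2
    _ = 2 / (1 - r) := by ring

/-- The critical index of a point: the last `n ≤ T` at which the gauge is comparable to
`e^{-n}`. -/
lemma exists_critical_index {p q s t : ℝ} (hst : |s| ^ p + |t| ^ q ≤ exp (-1)) {T : ℕ}
    (hT : 1 ≤ T) :
    ∃ K : ℕ, 1 ≤ K ∧ K ≤ T ∧ |K * s| ^ p + |K * t| ^ q ≤ exp (-K) ∧
      (K + 1 ≤ T → exp (-(K + 1 : ℕ)) ≤ |(K + 1 : ℕ) * s| ^ p + |(K + 1 : ℕ) * t| ^ q) := by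
  classical
  let P : ℕ → Prop := fun n => |n * s| ^ p + |n * t| ^ q ≤ exp (-n)
  have h1 : P 1 := by simpa [P] using hst
  refine ⟨Nat.findGreatest P T, Nat.le_findGreatest hT h1, Nat.findGreatest_le T,
    Nat.findGreatest_spec (P := P) hT h1, fun h => ?_⟩
  exact (not_le.mp (Nat.findGreatest_is_greatest (P := P) (Nat.lt_succ_self _) h)).le

lemma rpow_mul_le_abs_natCast_mul_rpow {p m s : ℝ} (hmp : m ≤ p) {K n : ℕ}
    (hK : 1 ≤ K) (hn : K ≤ n) :
    ((n : ℝ) / K) ^ m * |K * s| ^ p ≤ |n * s| ^ p := by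
  have hK0 : (0 : ℝ) < K := by exact_mod_cast hK
  have h1 : (1 : ℝ) ≤ n / K := by
    rw [one_le_div hK0]; exact_mod_cast hn
  have h2 : (n : ℝ) * s = (n / K) * (K * s) := by field_simp
  rw [h2, abs_mul (n / K : ℝ), abs_of_nonneg (by linarith : (0 : ℝ) ≤ n / K),
    mul_rpow (by linarith) (abs_nonneg _)]
  gcongr

/-- Beyond the critical index the gauge grows at least like a power. -/
lemma regGauge_lower_of_critical {p q m s t : ℝ} (hmp : m ≤ p) (hmq : m ≤ q) {K n : ℕ}
    (hc : exp (-(K + 1 : ℕ)) ≤ |(K + 1 : ℕ) * s| ^ p + |(K + 1 : ℕ) * t| ^ q)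
    (hn : K + 1 ≤ n) :
    ((n : ℝ) / (K + 1 : ℕ)) ^ m * exp (-(K + 1 : ℕ)) ≤ regGauge p q s t n := by
  have h1 := rpow_mul_le_abs_natCast_mul_rpow (s := s) hmp (Nat.succ_pos K) hn
  have h2 := rpow_mul_le_abs_natCast_mul_rpow (s := t) hmq (Nat.succ_pos K) hn
  have h3 : 0 ≤ ((n : ℝ) / (K + 1 : ℕ)) ^ m := by positivity
  have h4 := mul_le_mul_of_nonneg_left hc h3
  have h5 := exp_pos (-(n : ℝ))
  simp only [Nat.succ_eq_add_one] at h1 h2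
  unfold regGauge
  linarith

lemma gaugeSum_le_of_critical {p q m s t : ℝ} (hm : 1 < m) (hmp : m ≤ p) (hmq : m ≤ q) {K T : ℕ}
    (hK : 1 ≤ K) (hKT : K ≤ T)
    (hc : K + 1 ≤ T → exp (-(K + 1 : ℕ)) ≤ |(K + 1 : ℕ) * s| ^ p + |(K + 1 : ℕ) * t| ^ q) :
    gaugeSum p q T s t ≤ (2 + 2 ^ m * exp 1 / (m - 1)) * (K * exp K) := by
  have hK0 : (0 : ℝ) < K := by exact_mod_cast hK
  have hK1 : (1 : ℝ) ≤ K := by exact_mod_cast hK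
  have hm1 : 0 < m - 1 := by linarith
  unfold gaugeSum
  rw [Finset.range_eq_Ico, ← Finset.sum_Ico_consecutive _ (Nat.zero_le (K + 1)) (by omega), add_mul]
  refine add_le_add ?_ ?_
  · calc ∑ n ∈ Finset.Ico 0 (K + 1), (regGauge p q s t n)⁻¹
        ≤ ∑ n ∈ Finset.Ico 0 (K + 1), exp K := by
          refine Finset.sum_le_sum fun n hn => ?_
          have hnK : (n : ℝ) ≤ K := by
            have := (Finset.mem_Ico.mp hn).2
            exact_mod_cast (by omega : n ≤ K)
          calc (regGauge p q s t n)⁻¹ ≤ (exp (-n))⁻¹ := by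
                gcongr; exact exp_le_regGauge ..
            _ = exp n := by rw [← exp_neg, neg_neg]
            _ ≤ exp K := exp_le_exp.mpr hnK
      _ = (K + 1) * exp K := by simp
      _ ≤ 2 * (K * exp K) := by nlinarith [exp_pos (K : ℝ)]
  · rcases Nat.lt_or_ge T (K + 1) with h | h
    · rw [Finset.Ico_eq_empty (by omega), Finset.sum_empty]; positivity
    calc ∑ n ∈ Finset.Ico (K + 1) (T + 1), (regGauge p q s t n)⁻¹
        ≤ ∑ n ∈ Finset.Ico (K + 1) (T + 1),
            (((K + 1 : ℕ) : ℝ) ^ m * exp (K + 1 : ℕ)) * (n : ℝ) ^ (-m) := by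
          refine Finset.sum_le_sum fun n hn => ?_
          have hn1 := (Finset.mem_Ico.mp hn).1
          have hn0 : (0 : ℝ) < n := by exact_mod_cast (by omega : 0 < n)
          have h1 := regGauge_lower_of_critical hmp hmq (hc h) hn1
          calc (regGauge p q s t n)⁻¹
              ≤ (((n : ℝ) / (K + 1 : ℕ)) ^ m * exp (-(K + 1 : ℕ)))⁻¹ := by
                gcongr
            _ = _ := by
              rw [div_rpow hn0.le (by positivity), rpow_neg hn0.le, exp_neg]
              have : (0 : ℝ) < (n : ℝ) ^ m := by positivity
              have : (0 : ℝ) < ((K + 1 : ℕ) : ℝ) ^ m := by positivity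
              field_simp
      _ = (((K + 1 : ℕ) : ℝ) ^ m * exp (K + 1 : ℕ)) *
            ∑ n ∈ Finset.Ico (K + 1) (T + 1), (n : ℝ) ^ (-m) := by rw [Finset.mul_sum]
      _ ≤ ((2 * K : ℝ) ^ m * exp (K + 1 : ℕ)) * ((K : ℝ) ^ (1 - m) / (m - 1)) := by
          gcongr
          · push_cast; linarith
          · exact sum_Ico_rpow_neg_le hm hK T
      _ = _ := by
          rw [mul_rpow (by norm_num) hK0.le, rpow_sub hK0, rpow_one]
          push_cast
          rw [exp_add]
          have : (0 : ℝ) < (K : ℝ) ^ m := by positivity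
          field_simp

lemma le_gaugeDensity_of_critical {p q s t : ℝ} {K T : ℕ} (hKT : K ≤ T)
    (hK : |K * s| ^ p + |K * t| ^ q ≤ exp (-K)) :
    exp K ≤ 4 * gaugeDensity p q T s t := by
  have h1 : exp (-K) * ((regGauge p q s t K) ^ 2)⁻¹ ≤ gaugeDensity p q T s t :=
    Finset.single_le_sum (f := fun n : ℕ => exp (-(n : ℝ)) * ((regGauge p q s t n) ^ 2)⁻¹)
      (fun n _ => by positivity) (Finset.mem_range.mpr (by omega))
  have h2 : regGauge p q s t K ≤ 2 * exp (-K) := by unfold regGauge; linarith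
  have h3 : exp (-K) * ((2 * exp (-K)) ^ 2)⁻¹ ≤ exp (-K) * ((regGauge p q s t K) ^ 2)⁻¹ := by
    have := regGauge_pos p q s t K
    gcongr
  have h4 : exp (-(K : ℝ)) * ((2 * exp (-K)) ^ 2)⁻¹ = exp K / 4 := by
    rw [exp_neg]; have := exp_pos (K : ℝ); field_simp; norm_num
  linarith

/-- The terms of the derivative of the potential decay geometrically away from the critical
index. -/
lemma potential_term_le {p q s t : ℝ} (hpq : p.HolderConjugate q) {K T n : ℕ}
    (hc : K + 1 ≤ T → exp (-(K + 1 : ℕ)) ≤ |(K + 1 : ℕ) * s| ^ p + |(K + 1 : ℕ) * t| ^ q)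
    (hn : n ≤ T) :
    |(1 / ((n : ℝ) + 1)) * exp (-n) * ((regGauge p q s t n) ^ 2)⁻¹ * gaugeSlope p s n| ≤
      p * exp (1 + 1 / p) * exp (K / p) * exp (-1 / p) ^ ((n - K) + (K - n)) := by
  have hp := hpq.pos
  have hp1 := hpq.lt
  have hD := regGauge_pos p q s t n
  set D := regGauge p q s t n with hDdef
  have hslope : |gaugeSlope p s n| ≤ (n + 1) * (p * D ^ (1 - 1 / p)) := by
    have h1 : |gaugeSlope p s n| = n * (p * |n * s| ^ (p - 1)) := by
      unfold gaugeSlope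
      rw [abs_mul, abs_mul, abs_mul, abs_of_nonneg hp.le, Nat.abs_cast,
        abs_of_nonneg (by positivity : (0 : ℝ) ≤ |(n : ℝ) * s| ^ (p - 2))]
      rcases eq_or_ne ((n : ℝ) * s) 0 with h0 | h0
      · rw [h0, abs_zero, zero_rpow (by linarith : p - 1 ≠ 0)]; ring
      · have h0' : 0 < |(n : ℝ) * s| := abs_pos.mpr h0
        rw [show p - 1 = (p - 2) + 1 by ring, rpow_add_one h0'.ne']; ring
    have h2 : |n * s| ^ (p - 1) ≤ D ^ (1 - 1 / p) := by
      have h3 : |n * s| ^ (p - 1) = (|n * s| ^ p) ^ (1 - 1 / p) := by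
        rw [← rpow_mul (abs_nonneg _)]; congr 1; field_simp
      rw [h3]
      refine rpow_le_rpow (by positivity) ?_ ?_
      · have h4 : 0 ≤ |n * t| ^ q := by positivity
        have := exp_pos (-(n : ℝ))
        rw [hDdef]; unfold regGauge; linarith
      · rw [sub_nonneg, div_le_one hp]; exact hp1.le
    rw [h1]
    have : (0 : ℝ) ≤ D ^ (1 - 1 / p) := by positivity
    gcongr
    linarith
  have hterm : |(1 / ((n : ℝ) + 1)) * exp (-n) * (D ^ 2)⁻¹ * gaugeSlope p s n| ≤
      p * exp (-n) * D ^ (-(1 + 1 / p)) := by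
    rw [abs_mul, abs_of_nonneg (by positivity : 0 ≤ (1 / ((n : ℝ) + 1)) * exp (-n) * (D ^ 2)⁻¹)]
    refine (mul_le_mul_of_nonneg_left hslope (by positivity)).trans (le_of_eq ?_)
    have h5 : D ^ (-(1 + 1 / p)) = D ^ (1 - 1 / p) * (D ^ 2)⁻¹ := by
      rw [← rpow_natCast D 2, ← rpow_neg hD.le, ← rpow_add hD]; congr 1; push_cast; ring
    rw [h5]
    field_simp
  refine hterm.trans ?_
  have hpow : ∀ x : ℝ, exp (-x) ≤ D → D ^ (-(1 + 1 / p)) ≤ exp (x * (1 + 1 / p)) := by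
    intro x hx
    calc D ^ (-(1 + 1 / p)) ≤ (exp (-x)) ^ (-(1 + 1 / p)) :=
          rpow_le_rpow_of_nonpos (exp_pos _) hx (by
            have : 0 < 1 / p := by positivity
            linarith)
      _ = _ := by rw [← exp_mul]; congr 1; ring
  have hgoal : ∀ x : ℝ, exp (-x) ≤ D →
      -n + x * (1 + 1 / p) ≤ (1 + 1 / p) + K / p + ((n - K) + (K - n) : ℕ) * (-1 / p) →
      p * exp (-n) * D ^ (-(1 + 1 / p)) ≤
      p * exp (1 + 1 / p) * exp (K / p) * exp (-1 / p) ^ ((n - K) + (K - n)) := by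
    intro x hx h
    rw [← exp_nat_mul]
    calc p * exp (-n) * D ^ (-(1 + 1 / p)) ≤ p * exp (-n) * exp (x * (1 + 1 / p)) := by
          gcongr; exact hpow x hx
      _ = p * exp (-n + x * (1 + 1 / p)) := by rw [exp_add]; ring
      _ ≤ p * exp ((1 + 1 / p) + K / p + ((n - K) + (K - n) : ℕ) * (-1 / p)) := by gcongr
      _ = _ := by rw [exp_add, exp_add]; ring
  have hip : 0 < 1 / p := by positivity
  have hip1 : 1 / p ≤ 1 := by rw [div_le_one hp]; exact hp1.le
  rcases le_or_gt n K with h | h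
  · refine hgoal n (exp_le_regGauge ..) ?_
    have h6 : (((n - K) + (K - n) : ℕ) : ℝ) = K - n := by
      rw [Nat.sub_eq_zero_of_le h, zero_add, Nat.cast_sub h]
    rw [h6]
    have : -(n : ℝ) + n * (1 + 1 / p) = K / p + (K - n) * (-1 / p) := by ring
    linarith
  · refine hgoal (K + 1) ?_ ?_
    · have h7 := regGauge_lower_of_critical (m := 0) hp.le hpq.symm.pos.le
        (hc (by omega)) (by omega : K + 1 ≤ n)
      rw [rpow_zero, one_mul] at h7
      push_cast at h7
      exact h7
    · have h6 : (((n - K) + (K - n) : ℕ) : ℝ) = n - K := by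
        rw [Nat.sub_eq_zero_of_le h.le, add_zero, Nat.cast_sub h.le]
      rw [h6]
      have h8 : (K : ℝ) + 1 ≤ n := by exact_mod_cast h
      have h9 : (1 + 1 / p) + K / p + ((n : ℝ) - K) * (-1 / p)
          - (-n + (K + 1) * (1 + 1 / p)) = (n - K) * (1 - 1 / p) := by ring
      have h10 : 0 ≤ ((n : ℝ) - K) * (1 - 1 / p) := mul_nonneg (by linarith) (by linarith)
      linarith

/-- The partial derivative in `s` of `gaugePotential`, up to sign. -/
noncomputable def potentialSlope (p q : ℝ) (T : ℕ) (s t : ℝ) : ℝ :=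
  ∑ n ∈ Finset.range (T + 1),
    (1 / ((n : ℝ) + 1)) * exp (-n) * ((regGauge p q s t n) ^ 2)⁻¹ * gaugeSlope p s n

/-- The weight and the potential are controlled by the density, uniformly in the truncation. -/
lemma exists_gauge_bound {p q : ℝ} (hpq : p.HolderConjugate q) :
    ∃ C : ℝ, 0 ≤ C ∧ ∀ (T : ℕ) (s t : ℝ), 1 ≤ T → |s| ^ p + |t| ^ q ≤ exp (-1) →
      |s * gaugeSum p q T s t| ≤ C * gaugeDensity p q T s t ^ (1 / q) ∧
      |potentialSlope p q T s t| ≤ C * gaugeDensity p q T s t ^ (1 / p) := by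
  have hp := hpq.pos
  have hq := hpq.symm.pos
  set m := min p q with hm
  have hm1 : 1 < m := lt_min hpq.lt hpq.symm.lt
  set C₁ := 2 + 2 ^ m * exp 1 / (m - 1) with hC₁
  have hC₁0 : 0 ≤ C₁ := by
    have : 0 < m - 1 := by linarith
    positivity
  set r := exp (-1 / p) with hr
  have hr1 : r < 1 := by
    rw [hr, exp_lt_one_iff]; rw [neg_div]; exact neg_neg_of_pos (by positivity)
  set C₂ := p * exp (1 + 1 / p) * (2 / (1 - r)) with hC₂
  have hC₂0 : 0 ≤ C₂ := by
    have : 0 < 1 - r := by linarith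
    positivity
  refine ⟨C₁ * 4 ^ (1 / q) + C₂ * 4 ^ (1 / p), by positivity, fun T s t hT hst => ?_⟩
  obtain ⟨K, hK1, hKT, hKle, hc⟩ := exists_critical_index hst hT
  have hK0 : (0 : ℝ) < K := by exact_mod_cast hK1
  have hg := le_gaugeDensity_of_critical hKT hKle
  have hg0 := gaugeDensity_nonneg p q T s t
  set g := gaugeDensity p q T s t with hgdef
  have hpow : ∀ y : ℝ, 0 ≤ y → exp (K * y) ≤ 4 ^ y * g ^ y := by
    intro y hy
    rw [← mul_rpow (by norm_num) hg0, exp_mul]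
    exact rpow_le_rpow (exp_pos _).le hg hy
  constructor
  · have hΨ := gaugeSum_le_of_critical hm1 (min_le_left p q) (min_le_right p q) hK1 hKT hc
    have hΨ0 : 0 ≤ gaugeSum p q T s t :=
      Finset.sum_nonneg fun n _ => (inv_pos.mpr (regGauge_pos p q s t n)).le
    have hs : K * |s| ≤ exp (-(K / p)) := by
      have h1 : |K * s| ^ p ≤ exp (-K) := by
        have : 0 ≤ |K * t| ^ q := by positivity
        linarith
      have h2 := rpow_le_rpow (by positivity) h1 (by positivity : 0 ≤ 1 / p)
      rw [← rpow_mul (abs_nonneg _), mul_one_div_cancel hp.ne', rpow_one, ← exp_mul, abs_mul,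
        Nat.abs_cast] at h2
      refine h2.trans (le_of_eq ?_)
      congr 1; ring
    have hexp : exp (-(K / p)) * exp K = exp (K * (1 / q)) := by
      rw [← exp_add]; congr 1
      have : 1 / q = 1 - 1 / p := by
        have := hpq.inv_add_inv_eq_one
        rw [one_div, one_div]; linarith
      rw [this]; ring
    calc |s * gaugeSum p q T s t| = |s| * gaugeSum p q T s t := by
          rw [abs_mul, abs_of_nonneg hΨ0]
      _ ≤ |s| * (C₁ * (K * exp K)) := by gcongr
      _ = C₁ * ((K * |s|) * exp K) := by ring
      _ ≤ C₁ * (exp (-(K / p)) * exp K) := by gcongr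
      _ ≤ C₁ * (4 ^ (1 / q) * g ^ (1 / q)) := by
          rw [hexp]; gcongr; exact hpow _ (by positivity)
      _ ≤ (C₁ * 4 ^ (1 / q) + C₂ * 4 ^ (1 / p)) * g ^ (1 / q) := by
          have : 0 ≤ C₂ * 4 ^ (1 / p) * g ^ (1 / q) := by positivity
          linarith
  · calc |potentialSlope p q T s t|
        ≤ ∑ n ∈ Finset.range (T + 1),
            p * exp (1 + 1 / p) * exp (K / p) * r ^ ((n - K) + (K - n)) := by
          refine (Finset.abs_sum_le_sum_abs _ _).trans (Finset.sum_le_sum fun n hn => ?_)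
          exact potential_term_le hpq hc (by have := Finset.mem_range.mp hn; omega)
      _ = p * exp (1 + 1 / p) * exp (K / p) *
            ∑ n ∈ Finset.range (T + 1), r ^ ((n - K) + (K - n)) := by rw [Finset.mul_sum]
      _ ≤ p * exp (1 + 1 / p) * exp (K / p) * (2 / (1 - r)) := by
          gcongr; exact sum_pow_dist_le (exp_pos _).le hr1 K (T + 1)
      _ = C₂ * exp (K * (1 / p)) := by rw [hC₂, mul_one_div]; ring
      _ ≤ C₂ * (4 ^ (1 / p) * g ^ (1 / p)) := by gcongr; exact hpow _ (by positivity)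
      _ ≤ (C₁ * 4 ^ (1 / q) + C₂ * 4 ^ (1 / p)) * g ^ (1 / p) := by
          have : 0 ≤ C₁ * 4 ^ (1 / q) * g ^ (1 / p) := by positivity
          linarith

lemma hasDerivAt_abs_natCast_mul_rpow {p : ℝ} (hp : 1 < p) (n : ℕ) (s : ℝ) :
    HasDerivAt (fun s : ℝ => |n * s| ^ p) (gaugeSlope p s n) s := by
  have h1 := hasDerivAt_abs_rpow ((n : ℝ) * s) hp
  have h2 : HasDerivAt (fun s : ℝ => (n : ℝ) * s) n s := by
    simpa using (hasDerivAt_id s).const_mul (n : ℝ)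
  have h3 := h1.comp s h2
  rw [mul_comm] at h3
  exact h3

section composition

variable {E : Type*} [NormedAddCommGroup E] [NormedSpace ℝ E] {p q : ℝ} {u v : E → ℝ}

lemma hasFDerivAt_regGauge (hp : 1 < p) (hq : 1 < q) {u' v' : E →L[ℝ] ℝ} {x : E}
    (hu : HasFDerivAt u u' x) (hv : HasFDerivAt v v' x) (n : ℕ) :
    HasFDerivAt (fun x => regGauge p q (u x) (v x) n)
      (gaugeSlope p (u x) n • u' + gaugeSlope q (v x) n • v') x :=
  (((hasDerivAt_abs_natCast_mul_rpow hp n (u x)).comp_hasFDerivAt x hu).add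
    ((hasDerivAt_abs_natCast_mul_rpow hq n (v x)).comp_hasFDerivAt x hv)).add_const _

lemma hasFDerivAt_sum_inv_regGauge (hp : 1 < p) (hq : 1 < q) {u' v' : E →L[ℝ] ℝ} {x : E}
    (hu : HasFDerivAt u u' x) (hv : HasFDerivAt v v' x) (c : ℕ → ℝ) (T : ℕ) :
    HasFDerivAt (fun x => ∑ n ∈ Finset.range T, c n * (regGauge p q (u x) (v x) n)⁻¹)
      (-((∑ n ∈ Finset.range T,
          c n * ((regGauge p q (u x) (v x) n) ^ 2)⁻¹ * gaugeSlope p (u x) n) • u' +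
        (∑ n ∈ Finset.range T,
          c n * ((regGauge q p (v x) (u x) n) ^ 2)⁻¹ * gaugeSlope q (v x) n) • v')) x := by
  have h : ∀ n ∈ Finset.range T, HasFDerivAt (fun x => c n * (regGauge p q (u x) (v x) n)⁻¹)
      (c n • (-((regGauge p q (u x) (v x) n) ^ 2)⁻¹ •
        (gaugeSlope p (u x) n • u' + gaugeSlope q (v x) n • v'))) x := fun n _ =>
    ((hasDerivAt_inv (regGauge_pos p q (u x) (v x) n).ne').comp_hasFDerivAt x
      (hasFDerivAt_regGauge hp hq hu hv n)).const_mul (c n)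
  refine (HasFDerivAt.fun_sum h).congr_fderiv ?_
  ext w
  simp only [regGauge_comm q p, FunLike.coe_sum, Finset.sum_apply, smul_apply, add_apply, neg_apply,
    smul_eq_mul, Finset.sum_mul, ← Finset.sum_add_distrib, ← Finset.sum_neg_distrib]
  refine Finset.sum_congr rfl fun n _ => ?_
  ring

lemma contDiff_regGauge (hp : 1 < p) (hq : 1 < q) (hu : ContDiff ℝ 1 u) (hv : ContDiff ℝ 1 v)
    (n : ℕ) : ContDiff ℝ 1 fun x => regGauge p q (u x) (v x) n :=
  (((contDiff_const.mul hu).norm_rpow hp).add ((contDiff_const.mul hv).norm_rpow hq)).add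
    contDiff_const

lemma contDiff_sum_inv_regGauge (hp : 1 < p) (hq : 1 < q) (hu : ContDiff ℝ 1 u)
    (hv : ContDiff ℝ 1 v) (c : ℕ → ℝ) (T : ℕ) :
    ContDiff ℝ 1 fun x => ∑ n ∈ Finset.range T, c n * (regGauge p q (u x) (v x) n)⁻¹ :=
  ContDiff.sum fun n _ => contDiff_const.mul
    ((contDiff_regGauge hp hq hu hv n).inv fun x => (regGauge_pos p q (u x) (v x) n).ne')

end composition

/-- The partial derivative in `s` of `gaugeSum`, up to sign. -/
noncomputable def gaugeSumSlope (p q : ℝ) (T : ℕ) (s t : ℝ) : ℝ :=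
  ∑ n ∈ Finset.range (T + 1), ((regGauge p q s t n) ^ 2)⁻¹ * gaugeSlope p s n

lemma mul_gaugeSlope {p : ℝ} (hp : 0 < p) (s : ℝ) (n : ℕ) :
    s * gaugeSlope p s n = p * |n * s| ^ p := by
  unfold gaugeSlope
  rcases eq_or_ne ((n : ℝ) * s) 0 with h0 | h0
  · rw [h0, abs_zero, zero_rpow hp.ne']; ring
  · have h1 : |n * s| ^ p = |n * s| ^ (p - 2) * (n * s) ^ 2 := by
      rw [← sq_abs, ← rpow_natCast |n * s| 2, ← rpow_add (abs_pos.mpr h0)]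
      congr 1; push_cast; ring
    rw [h1]; ring

/-- The Euler-type identity behind the energy estimate. -/
lemma gaugeSum_sub_slopes {p q : ℝ} (hp : 0 < p) (hq : 0 < q) (T : ℕ) (s t : ℝ) :
    gaugeSum p q T s t - (s * gaugeSumSlope p q T s t / p + t * gaugeSumSlope q p T t s / q) =
      gaugeDensity p q T s t := by
  unfold gaugeSum gaugeSumSlope gaugeDensity
  rw [Finset.mul_sum, Finset.mul_sum, Finset.sum_div, Finset.sum_div, ← Finset.sum_add_distrib,
    ← Finset.sum_sub_distrib]
  refine Finset.sum_congr rfl fun n _ => ?_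
  have hD := regGauge_pos p q s t n
  have h1 := mul_gaugeSlope hp s n
  have h2 := mul_gaugeSlope hq t n
  rw [regGauge_comm q p]
  have h3 : s * (((regGauge p q s t n) ^ 2)⁻¹ * gaugeSlope p s n) / p =
      ((regGauge p q s t n) ^ 2)⁻¹ * |n * s| ^ p := by
    rw [show s * (((regGauge p q s t n) ^ 2)⁻¹ * gaugeSlope p s n) / p =
      ((regGauge p q s t n) ^ 2)⁻¹ * (s * gaugeSlope p s n) / p by ring, h1]
    field_simp
  have h4 : t * (((regGauge p q s t n) ^ 2)⁻¹ * gaugeSlope q t n) / q =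
      ((regGauge p q s t n) ^ 2)⁻¹ * |n * t| ^ q := by
    rw [show t * (((regGauge p q s t n) ^ 2)⁻¹ * gaugeSlope q t n) / q =
      ((regGauge p q s t n) ^ 2)⁻¹ * (t * gaugeSlope q t n) / q by ring, h2]
    field_simp
  rw [h3, h4]
  have h5 : exp (-(n : ℝ)) = regGauge p q s t n - |n * s| ^ p - |n * t| ^ q := by
    unfold regGauge; ring
  rw [h5]
  field_simp
  ring

/-- Young's inequality with a small constant in front of the power. -/
lemma exists_young_bound {r C ε : ℝ} (hr : 1 < r) (hC : 0 ≤ C) (hε : 0 < ε) :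
    ∃ C' : ℝ, 0 ≤ C' ∧ ∀ x : ℝ, 0 ≤ x → C * x ≤ ε * x ^ r + C' := by
  have hr1 : 0 < r - 1 := by linarith
  refine ⟨C * (C / ε) ^ (1 / (r - 1)), by positivity, fun x hx => ?_⟩
  rcases le_or_gt x ((C / ε) ^ (1 / (r - 1))) with h | h
  · have h1 := mul_le_mul_of_nonneg_left h hC
    have h2 : 0 ≤ ε * x ^ r := by positivity
    linarith
  · have hx0 : 0 < x := lt_of_le_of_lt (by positivity) h
    have h1 : C / ε ≤ x ^ (r - 1) := by
      have h2 := rpow_le_rpow (by positivity) h.le hr1.le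
      rwa [← rpow_mul (by positivity), one_div_mul_cancel hr1.ne', rpow_one] at h2
    have h3 : C ≤ ε * x ^ (r - 1) := by
      rw [div_le_iff₀ hε] at h1; linarith
    have h4 : x ^ r = x ^ (r - 1) * x := by
      rw [← rpow_add_one hx0.ne']; congr 1; ring
    have h5 := mul_le_mul_of_nonneg_right h3 hx0.le
    have h6 : 0 ≤ C * (C / ε) ^ (1 / (r - 1)) := by positivity
    rw [h4]; linarith

lemma integrableOn_ball_of_continuous {f : Plane → ℝ} (hf : Continuous f) (x : Plane) (r : ℝ) :
    IntegrableOn f (Metric.ball x r) :=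
  (hf.continuousOn.integrableOn_compact (isCompact_closedBall x r)).mono_set Metric.ball_subset_closedBall

lemma wedge_combination {p q : ℝ} (hpq : p⁻¹ + q⁻¹ = 1) (u' v' η' : Plane →L[ℝ] ℝ)
    (a s t ψ P Q : ℝ) :
    wedge (a • (s • (-(P • u' + Q • v')) + ψ • u') + (s * ψ) • η') v' / p -
      wedge (a • (t • (-(P • u' + Q • v')) + ψ • v') + (t * ψ) • η') u' / q =
    a * (ψ - (s * P / p + t * Q / q)) * wedge u' v' +
      (s * ψ / p * wedge η' v' - t * ψ / q * wedge η' u') := by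
  simp only [wedge, add_apply, smul_apply, neg_apply, smul_eq_mul]
  linear_combination (a * ψ * (u' (EuclideanSpace.single 0 1) * v' (EuclideanSpace.single 1 1) -
    u' (EuclideanSpace.single 1 1) * v' (EuclideanSpace.single 0 1))) * hpq

/-- Young's inequality in the form used to absorb cut-off terms. -/
lemma exists_cutoff_young {r C c : ℝ} (hr : 1 < r) (hC : 0 ≤ C) (hc : 0 < c) :
    ∃ C' : ℝ, 0 ≤ C' ∧ ∀ (j : ℕ) (G b e J : ℝ), (j : ℝ) + 1 ≤ j * r → 0 ≤ G → 0 ≤ b → 0 ≤ e →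
      e ≤ 1 → c * b ^ r ≤ J → C * (G ^ (1 / r) * b * e ^ j) ≤ e ^ (j + 1) * G * J / 4 + C' := by
  obtain ⟨C', hC', h⟩ := exists_young_bound hr hC (by positivity : 0 < c / 4)
  refine ⟨C', hC', fun j G b e J hj hG hb he he1 hJ => ?_⟩
  have hr0 : 0 < r := by linarith
  have h1 := h (G ^ (1 / r) * b * e ^ j) (by positivity)
  have h2 : (G ^ (1 / r) * b * e ^ j) ^ r = G * b ^ r * e ^ ((j : ℝ) * r) := by
    rw [mul_rpow (by positivity) (by positivity), mul_rpow (by positivity) hb, ← rpow_mul hG,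
      one_div_mul_cancel hr0.ne', rpow_one, ← rpow_natCast e j, ← rpow_mul he]
  have h3 : e ^ ((j : ℝ) * r) ≤ e ^ (j + 1) := by
    rw [← rpow_natCast e (j + 1)]
    exact rpow_le_rpow_of_exponent_ge' he he1 (by positivity) (by push_cast; exact hj)
  have h4 : c / 4 * (G * b ^ r * e ^ ((j : ℝ) * r)) ≤ e ^ (j + 1) * G * J / 4 := by
    calc c / 4 * (G * b ^ r * e ^ ((j : ℝ) * r)) ≤ c / 4 * (G * b ^ r * e ^ (j + 1)) := by gcongr
      _ = e ^ (j + 1) * G * (c * b ^ r) / 4 := by ring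
      _ ≤ _ := by gcongr
  rw [h2] at h1
  linarith

lemma exists_cutoff_exponent {p q : ℝ} (hpq : p.HolderConjugate q) :
    ∃ j : ℕ, 1 ≤ j ∧ (j : ℝ) + 1 ≤ j * p ∧ (j : ℝ) + 1 ≤ j * q := by
  have key : ∀ {p q : ℝ}, p.HolderConjugate q → ∀ j : ℕ, q ≤ j → (j : ℝ) + 1 ≤ j * p := by
    intro p q h j hj
    have h1 := h.sub_one_mul_conj
    have h2 := mul_le_mul_of_nonneg_left hj h.sub_one_pos.le
    linarith [h.lt]
  refine ⟨⌈max p q⌉₊, ?_, key hpq _ ?_, key hpq.symm _ ?_⟩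
  · exact Nat.one_le_ceil_iff.mpr (lt_max_of_lt_left hpq.pos)
  · exact (le_max_right p q).trans (Nat.le_ceil _)
  · exact (le_max_left p q).trans (Nat.le_ceil _)

section system

variable {p q : ℝ} {u v : Plane → ℝ} {c R : ℝ} {x₀ : Plane}

lemma continuous_gaugeDensity (hp : 1 < p) (hq : 1 < q) (hu : ContDiff ℝ 1 u)
    (hv : ContDiff ℝ 1 v) (T : ℕ) : Continuous fun x => gaugeDensity p q T (u x) (v x) := by
  unfold gaugeDensity
  refine continuous_finsetSum _ fun n _ => continuous_const.mul (Continuous.inv₀ ?_ fun x => ?_)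
  · exact (contDiff_regGauge hp hq hu hv n).continuous.pow 2
  · exact (pow_pos (regGauge_pos p q (u x) (v x) n) 2).ne'

/-- Testing the two equations `d(du) = 0 = d(dv)` with gauge weights and a cut-off. -/
lemma integral_cutoff_gauge_eq_zero (hpq : p.HolderConjugate q) (hu : ContDiff ℝ 1 u)
    (hv : ContDiff ℝ 1 v) {η : Plane → ℝ} (hη : ContDiff ℝ 1 η) (hηc : HasCompactSupport η)
    (j T : ℕ) :
    ∫ x, (η x ^ (j + 1) * gaugeDensity p q T (u x) (v x) * wedge (fderiv ℝ u x) (fderiv ℝ v x) +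
      (u x * gaugeSum p q T (u x) (v x) / p *
          wedge (((j + 1 : ℕ) * η x ^ j) • fderiv ℝ η x) (fderiv ℝ v x) -
        v x * gaugeSum p q T (u x) (v x) / q *
          wedge (((j + 1 : ℕ) * η x ^ j) • fderiv ℝ η x) (fderiv ℝ u x))) = 0 := by
  have hp := hpq.lt
  have hq := hpq.symm.lt
  let ψ : Plane → ℝ := fun x => gaugeSum p q T (u x) (v x)
  have hψ' : ∀ x, HasFDerivAt ψ (-(gaugeSumSlope p q T (u x) (v x) • fderiv ℝ u x +
      gaugeSumSlope q p T (v x) (u x) • fderiv ℝ v x)) x := by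
    intro x
    have h := hasFDerivAt_sum_inv_regGauge hp hq (hu.differentiable one_ne_zero x).hasFDerivAt
      (hv.differentiable one_ne_zero x).hasFDerivAt (fun _ => 1) (T + 1)
    simp only [one_mul] at h
    exact h
  have hψ : ContDiff ℝ 1 ψ := by
    have h := contDiff_sum_inv_regGauge hp hq hu hv (fun _ => 1) (T + 1)
    simp only [one_mul] at h
    exact h
  have hmain : ∀ w : Plane → ℝ, ContDiff ℝ 1 w → ∀ z : Plane → ℝ, ContDiff ℝ 1 z →
      Integrable (fun x => wedge (fderiv ℝ (fun x => η x ^ (j + 1) * (w x * ψ x)) x)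
        (fderiv ℝ z x)) ∧
      ∫ x, wedge (fderiv ℝ (fun x => η x ^ (j + 1) * (w x * ψ x)) x) (fderiv ℝ z x) = 0 := by
    intro w hw z hz
    have h1 : ContDiff ℝ 1 fun x => η x ^ (j + 1) * (w x * ψ x) := (hη.pow _).mul (hw.mul hψ)
    have h2 : HasCompactSupport fun x => η x ^ (j + 1) * (w x * ψ x) :=
      HasCompactSupport.mul_right (hηc.mono fun x hx h0 => hx (by simp [h0]))
    refine ⟨?_, integral_wedge_fderiv_eq_zero h1 h2 hz⟩
    refine (continuous_wedge.comp ((h1.continuous_fderiv one_ne_zero).prodMk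
      (hz.continuous_fderiv one_ne_zero))).integrable_of_hasCompactSupport ?_
    exact (h2.fderiv ℝ).mono fun x hx h0 => hx (by simp [wedge, h0])
  have hd : ∀ w : Plane → ℝ, ContDiff ℝ 1 w → ∀ x,
      fderiv ℝ (fun x => η x ^ (j + 1) * (w x * ψ x)) x =
      (η x ^ (j + 1)) • (w x • (-(gaugeSumSlope p q T (u x) (v x) • fderiv ℝ u x +
        gaugeSumSlope q p T (v x) (u x) • fderiv ℝ v x)) + ψ x • fderiv ℝ w x) +
      (w x * ψ x) • (((j + 1 : ℕ) * η x ^ j) • fderiv ℝ η x) := by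
    intro w hw x
    have h1 := ((hη.differentiable one_ne_zero x).hasFDerivAt.pow (j + 1)).mul
      ((hw.differentiable one_ne_zero x).hasFDerivAt.mul (hψ' x))
    refine h1.fderiv.trans ?_
    simp
  obtain ⟨hi1, h1⟩ := hmain u hu v hv
  obtain ⟨hi2, h2⟩ := hmain v hv u hu
  have h3 : ∫ x, (wedge (fderiv ℝ (fun x => η x ^ (j + 1) * (u x * ψ x)) x) (fderiv ℝ v x) / p -
      wedge (fderiv ℝ (fun x => η x ^ (j + 1) * (v x * ψ x)) x) (fderiv ℝ u x) / q) = 0 := by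
    rw [integral_sub (hi1.div_const p) (hi2.div_const q), integral_div, integral_div, h1, h2]
    simp
  rw [← h3]
  congr 1 with x
  rw [hd u hu, hd v hv, wedge_combination hpq.inv_add_inv_eq_one,
    ← gaugeSum_sub_slopes hpq.pos hpq.symm.pos]

lemma exists_integral_gaugeDensity_bound (hpq : p.HolderConjugate q) (hu : ContDiff ℝ 1 u)
    (hv : ContDiff ℝ 1 v) (hc : 0 < c) (hR : 0 < R)
    (hJ : ∀ x ∈ Metric.ball x₀ R, c * (‖fderiv ℝ u x‖ ^ p + ‖fderiv ℝ v x‖ ^ q) ≤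
      wedge (fderiv ℝ u x) (fderiv ℝ v x))
    (hsmall : ∀ x ∈ Metric.ball x₀ R, |u x| ^ p + |v x| ^ q ≤ exp (-1)) :
    ∃ M : ℝ, ∀ T : ℕ, 1 ≤ T → ∫ x in Metric.ball x₀ (R / 2),
      gaugeDensity p q T (u x) (v x) * wedge (fderiv ℝ u x) (fderiv ℝ v x) ≤ M := by
  have hp := hpq.lt
  have hq := hpq.symm.lt
  obtain ⟨C₁, hC₁, hb₁⟩ := exists_gauge_bound hpq
  obtain ⟨C₂, hC₂, hb₂⟩ := exists_gauge_bound hpq.symm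
  obtain ⟨j, hj1, hjp, hjq⟩ := exists_cutoff_exponent hpq
  let b : ContDiffBump x₀ := ⟨R / 2, R, half_pos hR, half_lt_self hR⟩
  let η : Plane → ℝ := b
  have hη : ContDiff ℝ 1 η := b.contDiff
  have hηc : HasCompactSupport η := b.hasCompactSupport
  have hη0 : ∀ x, 0 ≤ η x := fun x => b.nonneg
  have hη1 : ∀ x, η x ≤ 1 := fun x => b.le_one
  obtain ⟨L, hL⟩ := (hηc.fderiv ℝ).exists_bound_of_continuous (hη.continuous_fderiv one_ne_zero)
  have hL0 : 0 ≤ L := (norm_nonneg _).trans (hL 0)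
  obtain ⟨K₁, hK₁, hy₁⟩ := exists_cutoff_young (C := C₁ * (2 * ((j + 1 : ℕ) * L))) hq
    (by positivity) hc
  obtain ⟨K₂, hK₂, hy₂⟩ := exists_cutoff_young (C := C₂ * (2 * ((j + 1 : ℕ) * L))) hp
    (by positivity) hc
  refine ⟨2 * ((K₁ + K₂) * volume.real (Metric.ball x₀ R)), fun T hT => ?_⟩
  have hJ0 : ∀ x ∈ Metric.ball x₀ R, 0 ≤ wedge (fderiv ℝ u x) (fderiv ℝ v x) := fun x hx =>
    le_trans (by positivity) (hJ x hx)
  set g : Plane → ℝ := fun x => gaugeDensity p q T (u x) (v x) with hg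
  have hgc : Continuous g := continuous_gaugeDensity hp hq hu hv T
  have hJc : Continuous fun x => wedge (fderiv ℝ u x) (fderiv ℝ v x) :=
    continuous_wedge.comp ((hu.continuous_fderiv one_ne_zero).prodMk
      (hv.continuous_fderiv one_ne_zero))
  set B : Plane → ℝ := fun x => u x * gaugeSum p q T (u x) (v x) / p *
          wedge (((j + 1 : ℕ) * η x ^ j) • fderiv ℝ η x) (fderiv ℝ v x) -
        v x * gaugeSum p q T (u x) (v x) / q *
          wedge (((j + 1 : ℕ) * η x ^ j) • fderiv ℝ η x) (fderiv ℝ u x) with hB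
  have h0 : ∫ x, (η x ^ (j + 1) * g x * wedge (fderiv ℝ u x) (fderiv ℝ v x) + B x) = 0 :=
    integral_cutoff_gauge_eq_zero hpq hu hv hη hηc j T
  have hBc : Continuous B := by
    have h1 : Continuous fun x => gaugeSum p q T (u x) (v x) := by
      have h := (contDiff_sum_inv_regGauge hp hq hu hv (fun _ => 1) (T + 1)).continuous
      simp only [one_mul] at h
      exact h
    have h2 : Continuous fun x => ((j + 1 : ℕ) * η x ^ j) • fderiv ℝ η x :=
      (continuous_const.mul (hη.continuous.pow j)).smul (hη.continuous_fderiv one_ne_zero)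
    exact (((hu.continuous.mul h1).div_const p).mul (continuous_wedge.comp (h2.prodMk
      (hv.continuous_fderiv one_ne_zero)))).sub (((hv.continuous.mul h1).div_const q).mul
      (continuous_wedge.comp (h2.prodMk (hu.continuous_fderiv one_ne_zero))))
  have hB0 : ∀ x, x ∉ Metric.ball x₀ R →
      η x ^ (j + 1) * g x * wedge (fderiv ℝ u x) (fderiv ℝ v x) + B x = 0 := by
    intro x hx
    have h1 : η x = 0 := by
      rw [← b.support_eq] at hx
      exact Function.notMem_support.mp hx
    have h2 : (0 : ℝ) ^ j = 0 := zero_pow (by omega)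
    simp [hB, h1, h2, wedge]
  rw [← setIntegral_eq_integral_of_forall_compl_eq_zero hB0] at h0
  have hBle : ∀ x ∈ Metric.ball x₀ R,
      η x ^ (j + 1) * g x * wedge (fderiv ℝ u x) (fderiv ℝ v x) / 2 - (K₁ + K₂) ≤
      η x ^ (j + 1) * g x * wedge (fderiv ℝ u x) (fderiv ℝ v x) + B x := by
    intro x hx
    have hs := hsmall x hx
    have hJx := hJ x hx
    have hg0 : 0 ≤ g x := gaugeDensity_nonneg ..
    have hwη : ∀ M : Plane →L[ℝ] ℝ, |wedge (((j + 1 : ℕ) * η x ^ j) • fderiv ℝ η x) M| ≤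
        2 * ((j + 1 : ℕ) * L) * ‖M‖ * η x ^ j := by
      intro M
      rw [wedge_smul_left, abs_mul, abs_of_nonneg (by have := hη0 x; positivity)]
      have h1 := (abs_wedge_le (fderiv ℝ η x) M).trans
        (by gcongr; exact hL x : _ ≤ 2 * L * ‖M‖)
      refine (mul_le_mul_of_nonneg_left h1 (by have := hη0 x; positivity)).trans (le_of_eq ?_)
      ring
    have hdiv : ∀ {r : ℝ}, 1 < r → ∀ y : ℝ, |y / r| ≤ |y| := by
      intro r hr y
      rw [abs_div, abs_of_pos (by linarith : 0 < r)]
      exact div_le_self (abs_nonneg y) hr.le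
    have h1 : |u x * gaugeSum p q T (u x) (v x) / p *
        wedge (((j + 1 : ℕ) * η x ^ j) • fderiv ℝ η x) (fderiv ℝ v x)| ≤
        η x ^ (j + 1) * g x * wedge (fderiv ℝ u x) (fderiv ℝ v x) / 4 + K₁ := by
      rw [abs_mul]
      refine (mul_le_mul ((hdiv hp _).trans (hb₁ T _ _ hT hs).1) (hwη _) (abs_nonneg _)
        (by positivity)).trans ?_
      have h2 := hy₁ j (g x) ‖fderiv ℝ v x‖ (η x) (wedge (fderiv ℝ u x) (fderiv ℝ v x)) hjq hg0
        (norm_nonneg _) (hη0 x) (hη1 x) (by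
          have : 0 ≤ c * ‖fderiv ℝ u x‖ ^ p := by positivity
          linarith)
      refine le_trans (le_of_eq ?_) h2
      ring
    have h2 : |v x * gaugeSum p q T (u x) (v x) / q *
        wedge (((j + 1 : ℕ) * η x ^ j) • fderiv ℝ η x) (fderiv ℝ u x)| ≤
        η x ^ (j + 1) * g x * wedge (fderiv ℝ u x) (fderiv ℝ v x) / 4 + K₂ := by
      rw [abs_mul]
      have h3 := (hb₂ T (v x) (u x) hT (by linarith)).1
      rw [← gaugeSum_comm p q, ← gaugeDensity_comm p q] at h3
      refine (mul_le_mul ((hdiv hq _).trans h3) (hwη _) (abs_nonneg _)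
        (by positivity)).trans ?_
      have h2 := hy₂ j (g x) ‖fderiv ℝ u x‖ (η x) (wedge (fderiv ℝ u x) (fderiv ℝ v x)) hjp hg0
        (norm_nonneg _) (hη0 x) (hη1 x) (by
          have : 0 ≤ c * ‖fderiv ℝ v x‖ ^ q := by positivity
          linarith)
      refine le_trans (le_of_eq ?_) h2
      ring
    have h3 := (abs_le.mp h1).1
    have h4 := (abs_le.mp h2).2
    simp only [hB]
    linarith
  have hintegr : ∀ (f : Plane → ℝ) (r : ℝ), Continuous f → IntegrableOn f (Metric.ball x₀ r) :=
    fun f r hf => integrableOn_ball_of_continuous hf x₀ r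
  have hEc : Continuous fun x => η x ^ (j + 1) * g x * wedge (fderiv ℝ u x) (fderiv ℝ v x) :=
    ((hη.continuous.pow _).mul hgc).mul hJc
  have h5 : ∫ x in Metric.ball x₀ R,
      (η x ^ (j + 1) * g x * wedge (fderiv ℝ u x) (fderiv ℝ v x) / 2 - (K₁ + K₂)) ≤ 0 := by
    rw [← h0]
    exact setIntegral_mono_on (hintegr _ _ ((hEc.div_const 2).sub continuous_const))
      (hintegr _ _ (hEc.add hBc)) measurableSet_ball hBle
  rw [integral_sub (hintegr _ _ (hEc.div_const 2)) (hintegr _ _ continuous_const), integral_div,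
    setIntegral_const, smul_eq_mul] at h5
  have h6 : ∫ x in Metric.ball x₀ (R / 2), g x * wedge (fderiv ℝ u x) (fderiv ℝ v x) =
      ∫ x in Metric.ball x₀ (R / 2),
        η x ^ (j + 1) * g x * wedge (fderiv ℝ u x) (fderiv ℝ v x) := by
    refine setIntegral_congr_fun measurableSet_ball fun x hx => ?_
    have : η x = 1 := b.one_of_mem_closedBall (Metric.ball_subset_closedBall hx)
    simp [this]
  have h7 : ∫ x in Metric.ball x₀ (R / 2),
      η x ^ (j + 1) * g x * wedge (fderiv ℝ u x) (fderiv ℝ v x) ≤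
      ∫ x in Metric.ball x₀ R,
        η x ^ (j + 1) * g x * wedge (fderiv ℝ u x) (fderiv ℝ v x) := by
    refine setIntegral_mono_set (hintegr _ _ hEc) ?_
      (Metric.ball_subset_ball (by linarith)).eventuallyLE
    refine (ae_restrict_iff' measurableSet_ball).mpr (Filter.Eventually.of_forall fun x hx => ?_)
    exact mul_nonneg (mul_nonneg (pow_nonneg (hη0 x) _) (gaugeDensity_nonneg ..)) (hJ0 x hx)
  rw [h6]
  linarith

end system

lemma integral_ball_zero_add (F : Plane → ℝ) (a : Plane) (δ : ℝ) :
    ∫ z in Metric.ball 0 δ, F (a + z) = ∫ z in Metric.ball a δ, F z := by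
  have h := (measurePreserving_add_left volume a).setIntegral_preimage_emb
    (measurableEmbedding_addLeft a) F (Metric.ball a δ)
  rw [← h]
  congr 2
  ext z
  simp [dist_eq_norm]

/-- The integrals of a function over two balls of equal radius differ by at most the integral of
its gradient over a larger ball times the distance of the centres. -/
lemma abs_integral_ball_sub_le {H : Plane → ℝ} (hH : ContDiff ℝ 1 H) {x y x₀ : Plane} {δ ρ : ℝ}
    (hx : Metric.ball x δ ⊆ Metric.ball x₀ ρ) (hy : Metric.ball y δ ⊆ Metric.ball x₀ ρ) :
    |(∫ z in Metric.ball y δ, H z) - ∫ z in Metric.ball x δ, H z| ≤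
      ‖y - x‖ * ∫ z in Metric.ball x₀ ρ, ‖fderiv ℝ H z‖ := by
  set w := y - x with hw
  have hH' : Continuous (fderiv ℝ H) := hH.continuous_fderiv one_ne_zero
  let f : ℝ → ℝ := fun t => ∫ z in Metric.ball 0 δ, H (x + t • w + z)
  let f' : ℝ → ℝ := fun t => ∫ z in Metric.ball 0 δ, fderiv ℝ H (x + t • w + z) w
  have hf : ∀ t, HasDerivAt f (f' t) t := by
    intro t
    obtain ⟨B, hB⟩ := (isCompact_closedBall (0 : Plane)
      (‖x‖ + (|t| + 1) * ‖w‖ + δ)).exists_bound_of_continuousOn hH'.continuousOn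
    refine (hasDerivAt_integral_of_dominated_loc_of_deriv_le (bound := fun _ => B * ‖w‖)
      (F := fun t z => H (x + t • w + z)) (F' := fun t z => fderiv ℝ H (x + t • w + z) w)
      (Metric.ball_mem_nhds t one_pos) ?_ ?_ ?_ ?_ ?_ ?_).2
    · refine Filter.Eventually.of_forall fun t => Continuous.aestronglyMeasurable ?_
      exact hH.continuous.comp (by fun_prop)
    · exact integrableOn_ball_of_continuous (hH.continuous.comp (by fun_prop)) _ _
    · refine Continuous.aestronglyMeasurable ?_
      fun_prop
    · refine (ae_restrict_iff' measurableSet_ball).mpr (Filter.Eventually.of_forall ?_)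
      intro z hz r hr
      refine (ContinuousLinearMap.le_opNorm _ _).trans ?_
      gcongr
      refine hB _ ?_
      rw [mem_closedBall_zero_iff]
      rw [mem_ball_zero_iff] at hz
      have hr' : |r| ≤ |t| + 1 := by
        rw [Metric.mem_ball, Real.dist_eq] at hr
        have := abs_sub_abs_le_abs_sub r t
        linarith
      calc ‖x + r • w + z‖ ≤ ‖x‖ + ‖r • w‖ + ‖z‖ := norm_add₃_le
        _ ≤ ‖x‖ + (|t| + 1) * ‖w‖ + δ := by
          rw [norm_smul, Real.norm_eq_abs]
          gcongr
    · exact integrableOn_ball_of_continuous continuous_const _ _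
    · refine Filter.Eventually.of_forall fun z r _ => ?_
      have h1 : HasDerivAt (fun r : ℝ => x + r • w + z) w r := by
        have h2 := ((hasDerivAt_id r).smul_const w).const_add x |>.add_const z
        simpa using h2
      exact ((hH.differentiable one_ne_zero _).hasFDerivAt.comp_hasDerivAt r h1)
  have hbound : ∀ t ∈ Set.Ico (0 : ℝ) 1,
      ‖f' t‖ ≤ ‖w‖ * ∫ z in Metric.ball x₀ ρ, ‖fderiv ℝ H z‖ := by
    intro t ht
    have hsub : Metric.ball (x + t • w) δ ⊆ Metric.ball x₀ ρ := by
      intro z hz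
      have h1 : x + (z - (x + t • w)) ∈ Metric.ball x₀ ρ := by
        apply hx
        rw [Metric.mem_ball, dist_eq_norm] at hz ⊢
        simpa using hz
      have h2 : y + (z - (x + t • w)) ∈ Metric.ball x₀ ρ := by
        apply hy
        rw [Metric.mem_ball, dist_eq_norm] at hz ⊢
        simpa using hz
      have h3 := (convex_ball x₀ ρ) h1 h2 (by linarith [ht.2] : 0 ≤ 1 - t) ht.1 (by ring)
      convert h3 using 1
      rw [hw]
      module
    calc ‖f' t‖ ≤ ∫ z in Metric.ball 0 δ, ‖fderiv ℝ H (x + t • w + z) w‖ :=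
          norm_integral_le_integral_norm _
      _ ≤ ∫ z in Metric.ball 0 δ, ‖w‖ * ‖fderiv ℝ H (x + t • w + z)‖ := by
          refine setIntegral_mono_on (integrableOn_ball_of_continuous (by fun_prop) _ _)
            (integrableOn_ball_of_continuous (by fun_prop) _ _) measurableSet_ball fun z _ => ?_
          rw [mul_comm]
          exact ContinuousLinearMap.le_opNorm _ _
      _ = ‖w‖ * ∫ z in Metric.ball (x + t • w) δ, ‖fderiv ℝ H z‖ := by
          rw [integral_const_mul, integral_ball_zero_add (fun z => ‖fderiv ℝ H z‖)]
      _ ≤ _ := mul_le_mul_of_nonneg_left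
          (setIntegral_mono_set (integrableOn_ball_of_continuous hH'.norm _ _)
            (Filter.Eventually.of_forall fun z => norm_nonneg _) hsub.eventuallyLE) (norm_nonneg _)
  have h := norm_image_sub_le_of_norm_deriv_le_segment_01'
    (fun t _ => (hf t).hasDerivWithinAt) hbound
  have h1 : f 1 = ∫ z in Metric.ball y δ, H z := by
    have : x + (1 : ℝ) • w = y := by rw [hw]; module
    simp only [f, this]
    exact integral_ball_zero_add H y δ
  have h0 : f 0 = ∫ z in Metric.ball x δ, H z := by
    simp only [f, zero_smul, add_zero]
    exact integral_ball_zero_add H x δ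
  rw [h1, h0] at h
  exact h

section system

variable {p q : ℝ} {u v : Plane → ℝ} {c R : ℝ} {x₀ : Plane}

lemma contDiff_gaugePotential (hp : 1 < p) (hq : 1 < q) (hu : ContDiff ℝ 1 u)
    (hv : ContDiff ℝ 1 v) (T : ℕ) : ContDiff ℝ 1 fun x => gaugePotential p q T (u x) (v x) :=
  contDiff_sum_inv_regGauge hp hq hu hv (fun n => (1 / ((n : ℝ) + 1)) * exp (-n)) (T + 1)

lemma norm_fderiv_gaugePotential_le (hp : 1 < p) (hq : 1 < q) (hu : ContDiff ℝ 1 u)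
    (hv : ContDiff ℝ 1 v) (T : ℕ) (x : Plane) :
    ‖fderiv ℝ (fun x => gaugePotential p q T (u x) (v x)) x‖ ≤
      |potentialSlope p q T (u x) (v x)| * ‖fderiv ℝ u x‖ +
        |potentialSlope q p T (v x) (u x)| * ‖fderiv ℝ v x‖ := by
  have h : HasFDerivAt (fun x => gaugePotential p q T (u x) (v x))
      (-(potentialSlope p q T (u x) (v x) • fderiv ℝ u x +
        potentialSlope q p T (v x) (u x) • fderiv ℝ v x)) x :=
    hasFDerivAt_sum_inv_regGauge hp hq (hu.differentiable one_ne_zero x).hasFDerivAt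
      (hv.differentiable one_ne_zero x).hasFDerivAt
      (fun n => (1 / ((n : ℝ) + 1)) * exp (-n)) (T + 1)
  rw [h.fderiv, norm_neg]
  refine (norm_add_le _ _).trans ?_
  rw [norm_smul, norm_smul, Real.norm_eq_abs, Real.norm_eq_abs]

lemma exists_integral_fderiv_potential_bound (hpq : p.HolderConjugate q) (hu : ContDiff ℝ 1 u)
    (hv : ContDiff ℝ 1 v) (hc : 0 < c) (hR : 0 < R)
    (hJ : ∀ x ∈ Metric.ball x₀ R, c * (‖fderiv ℝ u x‖ ^ p + ‖fderiv ℝ v x‖ ^ q) ≤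
      wedge (fderiv ℝ u x) (fderiv ℝ v x))
    (hsmall : ∀ x ∈ Metric.ball x₀ R, |u x| ^ p + |v x| ^ q ≤ exp (-1)) :
    ∃ M : ℝ, ∀ T : ℕ, 1 ≤ T → ∫ x in Metric.ball x₀ (R / 2),
      ‖fderiv ℝ (fun x => gaugePotential p q T (u x) (v x)) x‖ ≤ M := by
  have hp := hpq.lt
  have hq := hpq.symm.lt
  obtain ⟨M, hM⟩ := exists_integral_gaugeDensity_bound hpq hu hv hc hR hJ hsmall
  obtain ⟨C₁, hC₁, hb₁⟩ := exists_gauge_bound hpq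
  obtain ⟨C₂, hC₂, hb₂⟩ := exists_gauge_bound hpq.symm
  obtain ⟨j, hj1, hjp, hjq⟩ := exists_cutoff_exponent hpq
  obtain ⟨K₁, hK₁, hy₁⟩ := exists_cutoff_young (C := C₁) hp hC₁ hc
  obtain ⟨K₂, hK₂, hy₂⟩ := exists_cutoff_young (C := C₂) hq hC₂ hc
  refine ⟨M + (K₁ + K₂) * volume.real (Metric.ball x₀ (R / 2)), fun T hT => ?_⟩
  have hgJ : Continuous fun x =>
      gaugeDensity p q T (u x) (v x) * wedge (fderiv ℝ u x) (fderiv ℝ v x) :=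
    (continuous_gaugeDensity hp hq hu hv T).mul (continuous_wedge.comp
      ((hu.continuous_fderiv one_ne_zero).prodMk (hv.continuous_fderiv one_ne_zero)))
  have hle : ∀ x ∈ Metric.ball x₀ (R / 2),
      ‖fderiv ℝ (fun x => gaugePotential p q T (u x) (v x)) x‖ ≤
      gaugeDensity p q T (u x) (v x) * wedge (fderiv ℝ u x) (fderiv ℝ v x) + (K₁ + K₂) := by
    intro x hx
    have hxR : x ∈ Metric.ball x₀ R := Metric.ball_subset_ball (by linarith) hx
    have hg0 := gaugeDensity_nonneg p q T (u x) (v x)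
    have hs := hsmall x hxR
    have hJx := hJ x hxR
    have ha : 0 ≤ c * ‖fderiv ℝ u x‖ ^ p := by positivity
    have hb : 0 ≤ c * ‖fderiv ℝ v x‖ ^ q := by positivity
    have h1 := hy₁ j _ ‖fderiv ℝ u x‖ 1 (wedge (fderiv ℝ u x) (fderiv ℝ v x)) hjp hg0
      (norm_nonneg _) zero_le_one le_rfl (by linarith)
    have h2 := hy₂ j _ ‖fderiv ℝ v x‖ 1 (wedge (fderiv ℝ u x) (fderiv ℝ v x)) hjq hg0
      (norm_nonneg _) zero_le_one le_rfl (by linarith)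
    have h3 := (hb₁ T (u x) (v x) hT hs).2
    have h4 := (hb₂ T (v x) (u x) hT (by linarith)).2
    rw [← gaugeDensity_comm p q] at h4
    have h5 := mul_le_mul_of_nonneg_right h3 (norm_nonneg (fderiv ℝ u x))
    have h6 := mul_le_mul_of_nonneg_right h4 (norm_nonneg (fderiv ℝ v x))
    have h7 := norm_fderiv_gaugePotential_le hp hq hu hv T x
    have h8 : 0 ≤ gaugeDensity p q T (u x) (v x) * wedge (fderiv ℝ u x) (fderiv ℝ v x) :=
      mul_nonneg hg0 (by linarith)
    simp only [one_pow, one_mul, mul_one] at h1 h2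
    linarith
  have hcont := ((contDiff_gaugePotential hp hq hu hv T).continuous_fderiv one_ne_zero).norm
  refine (setIntegral_mono_on (integrableOn_ball_of_continuous hcont _ _)
    (integrableOn_ball_of_continuous (hgJ.add continuous_const) _ _)
    measurableSet_ball hle).trans ?_
  rw [integral_add' (integrableOn_ball_of_continuous hgJ _ _)
    (integrableOn_ball_of_continuous continuous_const _ _), setIntegral_const, smul_eq_mul]
  linarith [hM T hT]

lemma gaugePotential_zero (hp : 0 < p) (hq : 0 < q) (T : ℕ) :
    gaugePotential p q T 0 0 = ∑ n ∈ Finset.range (T + 1), 1 / ((n : ℝ) + 1) := by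
  refine Finset.sum_congr rfl fun n _ => ?_
  have : regGauge p q 0 0 n = exp (-n) := by
    simp [regGauge, zero_rpow hp.ne', zero_rpow hq.ne']
  rw [this, mul_assoc, mul_inv_cancel₀ (exp_pos _).ne', mul_one]

lemma gaugePotential_le (hp : 0 < p) (hq : 0 < q) {d s t : ℝ} (hd : 0 < d)
    (hst : d ≤ |s| ^ p + |t| ^ q) (T : ℕ) :
    gaugePotential p q T s t ≤ 1 + 1 / d * (1 / (1 - exp (-1))) := by
  have he : exp (-1) < 1 := by rw [exp_lt_one_iff]; norm_num
  unfold gaugePotential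
  rw [Finset.sum_range_succ', add_comm]
  refine add_le_add (le_of_eq ?_) ?_
  · simp [regGauge, zero_rpow hp.ne', zero_rpow hq.ne']
  · calc _ ≤ ∑ n ∈ Finset.range T, 1 / d * exp (-1) ^ n := by
          refine Finset.sum_le_sum fun n _ => ?_
          have hone : (1 : ℝ) ≤ (n + 1 : ℕ) := by push_cast; linarith [n.cast_nonneg (α := ℝ)]
          have hpow : ∀ {r : ℝ}, 0 < r → ∀ y : ℝ, |y| ^ r ≤ |(n + 1 : ℕ) * y| ^ r := by
            intro r hr y
            refine rpow_le_rpow (abs_nonneg _) ?_ hr.le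
            rw [abs_mul, Nat.abs_cast]
            exact le_mul_of_one_le_left (abs_nonneg _) hone
          have hD : d ≤ regGauge p q s t (n + 1) := by
            have h1 := hpow hp s
            have h2 := hpow hq t
            have h3 := exp_pos (-((n + 1 : ℕ) : ℝ))
            unfold regGauge
            linarith
          have hD0 : 0 < regGauge p q s t (n + 1) := hd.trans_le hD
          have hn : 1 / (((n + 1 : ℕ) : ℝ) + 1) ≤ 1 := by
            rw [div_le_one (by positivity)]; linarith
          calc 1 / (((n + 1 : ℕ) : ℝ) + 1) * exp (-(n + 1 : ℕ)) * (regGauge p q s t (n + 1))⁻¹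
              ≤ 1 * exp (-n) * d⁻¹ := by
                gcongr
                exact n.le_succ
            _ = 1 / d * exp (-1) ^ n := by
                rw [← exp_nat_mul, one_div, mul_neg_one]; ring
      _ = 1 / d * ∑ n ∈ Finset.range T, exp (-1) ^ n := by rw [Finset.mul_sum]
      _ ≤ 1 / d * (1 / (1 - exp (-1))) := by
          gcongr
          rw [one_div (1 - _), ← tsum_geometric_of_lt_one (exp_pos _).le he]
          exact (summable_geometric_of_lt_one (exp_pos _).le he).sum_le_tsum _
            fun n _ => by positivity

/-- **Unique continuation for planar pairs.** If `du ∧ dv` controls `|du|^p + |dv|^q` on a ball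
and `u`, `v` vanish on some small ball, then they vanish on the ball of half the radius. -/
theorem eq_zero_of_wedge_coercive (hpq : p.HolderConjugate q) (hu : ContDiff ℝ 1 u)
    (hv : ContDiff ℝ 1 v) (hc : 0 < c) (hR : 0 < R)
    (hJ : ∀ x ∈ Metric.ball x₀ R, c * (‖fderiv ℝ u x‖ ^ p + ‖fderiv ℝ v x‖ ^ q) ≤
      wedge (fderiv ℝ u x) (fderiv ℝ v x))
    (hsmall : ∀ x ∈ Metric.ball x₀ R, |u x| ^ p + |v x| ^ q ≤ exp (-1))
    {y : Plane} {δ : ℝ} (hδ : 0 < δ) (hy : Metric.ball y δ ⊆ Metric.ball x₀ (R / 2))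
    (hy0 : ∀ x ∈ Metric.ball y δ, u x = 0 ∧ v x = 0) :
    ∀ x ∈ Metric.ball x₀ (R / 2), u x = 0 ∧ v x = 0 := by
  have hp := hpq.lt
  have hq := hpq.symm.lt
  intro x hx
  by_contra hne
  have hpos : 0 < |u x| ^ p + |v x| ^ q := by
    rcases not_and_or.mp hne with h | h
    · have := rpow_pos_of_pos (abs_pos.mpr h) p
      positivity
    · have := rpow_pos_of_pos (abs_pos.mpr h) q
      positivity
  set d := (|u x| ^ p + |v x| ^ q) / 2 with hd
  have hd0 : 0 < d := half_pos hpos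
  have hcont : Continuous fun x => |u x| ^ p + |v x| ^ q :=
    (hu.continuous.abs.rpow_const fun _ => Or.inr (by linarith)).add
      (hv.continuous.abs.rpow_const fun _ => Or.inr (by linarith))
  have hnear : ∀ᶠ z in nhds x, z ∈ Metric.ball x₀ (R / 2) ∧ d < |u z| ^ p + |v z| ^ q :=
    Filter.Eventually.and (Metric.isOpen_ball.mem_nhds hx)
      (hcont.continuousAt.eventually (lt_mem_nhds (half_lt_self hpos)))
  obtain ⟨ε, hε, hball⟩ := Metric.eventually_nhds_iff_ball.mp hnear
  set r := min δ ε with hr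
  have hr0 : 0 < r := lt_min hδ hε
  have hyr : Metric.ball y r ⊆ Metric.ball y δ := Metric.ball_subset_ball (min_le_left _ _)
  have hxr : Metric.ball x r ⊆ Metric.ball x ε := Metric.ball_subset_ball (min_le_right _ _)
  obtain ⟨M, hM⟩ := exists_integral_fderiv_potential_bound hpq hu hv hc hR hJ hsmall
  set V := volume.real (Metric.ball (0 : Plane) r) with hV
  have hV0 : 0 < V :=
    ENNReal.toReal_pos (Metric.measure_ball_pos volume _ hr0).ne' measure_ball_lt_top.ne
  have hvol : ∀ z : Plane, volume.real (Metric.ball z r) = V := fun z => by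
    rw [hV, measureReal_def, measureReal_def, Measure.addHaar_ball_center]
  set C := 1 + 1 / d * (1 / (1 - exp (-1))) with hC
  have hbound : ∀ T : ℕ, 1 ≤ T →
      ∑ n ∈ Finset.range (T + 1), 1 / ((n : ℝ) + 1) ≤ C + ‖y - x‖ * M / V := by
    intro T hT
    have hH := contDiff_gaugePotential hp hq hu hv T
    have h1 := (le_abs_self _).trans (abs_integral_ball_sub_le hH
      (hxr.trans fun z hz => (hball z hz).1) (hyr.trans hy))
    have h2 : ∫ z in Metric.ball y r, gaugePotential p q T (u z) (v z) =
        V * ∑ n ∈ Finset.range (T + 1), 1 / ((n : ℝ) + 1) := by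
      rw [← hvol y, ← smul_eq_mul, ← setIntegral_const]
      refine setIntegral_congr_fun measurableSet_ball fun z hz => ?_
      obtain ⟨h3, h4⟩ := hy0 z (hyr hz)
      simp only [h3, h4]
      exact gaugePotential_zero (by linarith) (by linarith) T
    have h3 : ∫ z in Metric.ball x r, gaugePotential p q T (u z) (v z) ≤ V * C := by
      rw [← hvol x, ← smul_eq_mul, ← setIntegral_const]
      refine setIntegral_mono_on (integrableOn_ball_of_continuous hH.continuous _ _)
        (integrableOn_ball_of_continuous continuous_const _ _) measurableSet_ball fun z hz => ?_
      exact gaugePotential_le (by linarith) (by linarith) hd0 (hball z (hxr hz)).2.le T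
    have h4 := mul_le_mul_of_nonneg_left (hM T hT) (norm_nonneg (y - x))
    rw [h2] at h1
    rw [← sub_le_iff_le_add', le_div_iff₀ hV0]
    linarith
  have hdiv := Real.tendsto_sum_range_one_div_nat_succ_atTop.eventually_gt_atTop
    (C + ‖y - x‖ * M / V)
  obtain ⟨N, hN⟩ := Filter.eventually_atTop.mp hdiv
  have h1 := hN (max N 1 + 1) (by have := le_max_left N 1; omega)
  have h2 := hbound (max N 1) (le_max_right N 1)
  linarith

end system

section flux

variable {E : Type*} [NormedAddCommGroup E] [InnerProductSpace ℝ E]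

/-- The flux `|Bξ·ξ|^((p-2)/2) Bξ` of the `p`-energy attached to the quadratic form of `B`. -/
noncomputable def flux (p : ℝ) (B : E →L[ℝ] E) (ξ : E) : E :=
  |⟪B ξ, ξ⟫| ^ ((p - 2) / 2) • B ξ

variable {p c K : ℝ} {B : E →L[ℝ] E}

lemma flux_zero (p : ℝ) (B : E →L[ℝ] E) : flux p B 0 = 0 := by simp [flux]

lemma inner_form_pos (hc : 0 < c) (hell : ∀ ξ, c * ‖ξ‖ ^ 2 ≤ ⟪B ξ, ξ⟫) {ξ : E} (hξ : ξ ≠ 0) :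
    0 < ⟪B ξ, ξ⟫ :=
  (by positivity : 0 < c * ‖ξ‖ ^ 2).trans_le (hell ξ)

lemma inner_form_nonneg (hc : 0 < c) (hell : ∀ ξ, c * ‖ξ‖ ^ 2 ≤ ⟪B ξ, ξ⟫) (ξ : E) :
    0 ≤ ⟪B ξ, ξ⟫ :=
  (by positivity : 0 ≤ c * ‖ξ‖ ^ 2).trans (hell ξ)

lemma inner_flux_self (hp : 1 < p) (hc : 0 < c) (hell : ∀ ξ, c * ‖ξ‖ ^ 2 ≤ ⟪B ξ, ξ⟫) (ξ : E) :
    ⟪flux p B ξ, ξ⟫ = ⟪B ξ, ξ⟫ ^ (p / 2) := by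
  rcases eq_or_ne ξ 0 with rfl | hξ
  · simp [flux, zero_rpow (by linarith : p / 2 ≠ 0)]
  · have h := inner_form_pos hc hell hξ
    rw [flux, real_inner_smul_left, abs_of_pos h, ← rpow_add_one h.ne']
    congr 1; ring

lemma norm_flux_le (hp : 1 < p) (hc : 0 < c) (hell : ∀ ξ, c * ‖ξ‖ ^ 2 ≤ ⟪B ξ, ξ⟫)
    (hK : ‖B‖ ≤ K) (ξ : E) : ‖flux p B ξ‖ ≤ K / √c * ⟪B ξ, ξ⟫ ^ ((p - 1) / 2) := by
  have hK0 : 0 ≤ K := (norm_nonneg _).trans hK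
  rcases eq_or_ne ξ 0 with rfl | hξ
  · simp [flux, zero_rpow (by linarith : (p - 1) / 2 ≠ 0)]
  · have h := inner_form_pos hc hell hξ
    have h1 : ‖ξ‖ ≤ √⟪B ξ, ξ⟫ / √c := by
      rw [le_div_iff₀ (sqrt_pos.mpr hc)]
      refine le_sqrt_of_sq_le ?_
      rw [mul_pow, sq_sqrt hc.le, mul_comm]
      exact hell ξ
    have h2 : ‖B ξ‖ ≤ K * (√⟪B ξ, ξ⟫ / √c) :=
      (B.le_opNorm ξ).trans (mul_le_mul hK h1 (norm_nonneg _) hK0)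
    rw [flux, norm_smul, abs_of_pos h, Real.norm_of_nonneg (rpow_nonneg h.le _)]
    have h3 : ⟪B ξ, ξ⟫ ^ ((p - 1) / 2) = ⟪B ξ, ξ⟫ ^ ((p - 2) / 2) * √⟪B ξ, ξ⟫ := by
      rw [sqrt_eq_rpow, ← rpow_add h]
      congr 1; ring
    rw [h3]
    calc _ ≤ ⟪B ξ, ξ⟫ ^ ((p - 2) / 2) * (K * (√⟪B ξ, ξ⟫ / √c)) := by gcongr
      _ = _ := by ring

/-- Cauchy–Schwarz for the form of a symmetric coercive operator. -/
lemma inner_form_le (hc : 0 < c) (hsymm : ∀ ξ ζ, ⟪B ξ, ζ⟫ = ⟪ξ, B ζ⟫)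
    (hell : ∀ ξ, c * ‖ξ‖ ^ 2 ≤ ⟪B ξ, ξ⟫) (ξ ζ : E) :
    ⟪B ξ, ζ⟫ ≤ √⟪B ξ, ξ⟫ * √⟪B ζ, ζ⟫ := by
  rcases eq_or_ne ξ 0 with rfl | hξ
  · simp
  rcases eq_or_ne ζ 0 with rfl | hζ
  · simp
  have ha := sqrt_pos.mpr (inner_form_pos hc hell hξ)
  have hb := sqrt_pos.mpr (inner_form_pos hc hell hζ)
  have ha2 := sq_sqrt (inner_form_nonneg hc hell ξ)
  have hb2 := sq_sqrt (inner_form_nonneg hc hell ζ)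
  set a := √⟪B ξ, ξ⟫
  set b := √⟪B ζ, ζ⟫
  have h := inner_form_nonneg hc hell (b • ξ - a • ζ)
  have hs : ⟪B ζ, ξ⟫ = ⟪B ξ, ζ⟫ := by rw [hsymm, real_inner_comm]
  simp only [map_sub, map_smul, inner_sub_left, inner_sub_right, real_inner_smul_left,
    real_inner_smul_right, hs, ← ha2, ← hb2] at h
  have h2 : 0 ≤ (a * b) * (a * b - ⟪B ξ, ζ⟫) := by nlinarith
  have := nonneg_of_mul_nonneg_right h2 (mul_pos ha hb)
  linarith

/-- Strict convexity of `ξ ↦ (Bξ·ξ)^(p/2)`. -/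
lemma rpow_inner_form_lt (hp : 1 < p) (hc : 0 < c) (hsymm : ∀ ξ ζ, ⟪B ξ, ζ⟫ = ⟪ξ, B ζ⟫)
    (hell : ∀ ξ, c * ‖ξ‖ ^ 2 ≤ ⟪B ξ, ξ⟫) {ξ ζ : E} (hne : ζ ≠ ξ) :
    ⟪B ξ, ξ⟫ ^ (p / 2) + p * ⟪flux p B ξ, ζ - ξ⟫ < ⟪B ζ, ζ⟫ ^ (p / 2) := by
  rcases eq_or_ne ξ 0 with rfl | hξ
  · simpa [flux, zero_rpow (by linarith : p / 2 ≠ 0)] using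
      rpow_pos_of_pos (inner_form_pos hc hell hne) (p / 2)
  have hQ := inner_form_pos hc hell hξ
  have ha := sqrt_pos.mpr hQ
  have hb := sqrt_nonneg ⟪B ζ, ζ⟫
  have hcs := inner_form_le hc hsymm hell ξ ζ
  have ha2 := sq_sqrt (inner_form_nonneg hc hell ξ)
  have hb2 := sq_sqrt (inner_form_nonneg hc hell ζ)
  rw [inner_sub_right, inner_flux_self hp hc hell, flux, real_inner_smul_left, abs_of_pos hQ]
  have hpw : ∀ ω : E, ⟪B ω, ω⟫ ^ (p / 2) = √⟪B ω, ω⟫ ^ p := fun ω => by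
    rw [sqrt_eq_rpow, ← rpow_mul (inner_form_nonneg hc hell ω)]; congr 1; ring
  have hpw2 : ⟪B ξ, ξ⟫ ^ ((p - 2) / 2) = √⟪B ξ, ξ⟫ ^ p / √⟪B ξ, ξ⟫ ^ 2 := by
    rw [← hpw, ha2, ← rpow_sub_one hQ.ne']; congr 1; ring
  rw [hpw, hpw, hpw2]
  have hs : ⟪B ζ, ξ⟫ = ⟪B ξ, ζ⟫ := by rw [hsymm, real_inner_comm]
  have hd := inner_form_pos hc hell (sub_ne_zero.mpr hne)
  set a := √⟪B ξ, ξ⟫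
  set b := √⟪B ζ, ζ⟫
  simp only [map_sub, inner_sub_left, inner_sub_right, hs, ← ha2, ← hb2] at hd
  set m := ⟪B ξ, ζ⟫
  have hap : 0 < a ^ p := rpow_pos_of_pos ha p
  have hbp : b ^ p = a ^ p * (1 + (b / a - 1)) ^ p := by
    rw [← mul_rpow ha.le (by rw [add_sub_cancel]; positivity)]
    congr 1; field_simp; ring
  have hs1 : -1 ≤ b / a - 1 := by
    have : 0 ≤ b / a := by positivity
    linarith
  have hm : m / a ^ 2 ≤ b / a := by
    rw [div_le_div_iff₀ (by positivity) ha]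
    nlinarith
  have key : 1 + p * (m / a ^ 2 - 1) < (1 + (b / a - 1)) ^ p := by
    rcases eq_or_ne (b / a - 1) 0 with h | h
    · have hba : b = a := by
        have : b / a = 1 := by linarith
        field_simp at this
        exact this
      rw [h, add_zero, one_rpow]
      have : m / a ^ 2 < 1 := by
        rw [div_lt_one (by positivity)]
        rw [hba] at hd
        linarith
      nlinarith
    · refine lt_of_le_of_lt ?_ (one_add_mul_self_lt_rpow_one_add hs1 h hp)
      nlinarith
  rw [hbp]
  have := mul_lt_mul_of_pos_left key hap
  calc _ = a ^ p * (1 + p * (m / a ^ 2 - 1)) := by ring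
    _ < _ := this

end flux

section gradient

variable {Ω : Set Plane} {u : Plane → ℝ}

lemma norm_gradient (u : Plane → ℝ) (x : Plane) : ‖gradient u x‖ = ‖fderiv ℝ u x‖ := by
  simp [gradient]

lemma continuousOn_gradient (hΩ : IsOpen Ω) (hu : ContDiffOn ℝ 1 u (closure Ω)) :
    ContinuousOn (gradient u) Ω :=
  (LinearIsometryEquiv.continuous _).comp_continuousOn
    ((hu.mono subset_closure).continuousOn_fderiv_of_isOpen hΩ le_rfl)

lemma differentiableAt_of_contDiffOn_closure (hΩ : IsOpen Ω) (hu : ContDiffOn ℝ 1 u (closure Ω))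
    {x : Plane} (hx : x ∈ Ω) : DifferentiableAt ℝ u x :=
  (hu.differentiableOn one_ne_zero).differentiableAt
    (Filter.mem_of_superset (hΩ.mem_nhds hx) subset_closure)

lemma exists_norm_gradient_le (hΩ : IsOpen Ω) (hb : Bornology.IsBounded Ω)
    (hu : ContDiffOn ℝ 1 u (closure Ω)) : ∃ L, ∀ x ∈ Ω, ‖gradient u x‖ ≤ L := by
  have h : ∃ L, ∀ x ∈ closure Ω ∩ Ω, ‖gradient u x‖ ≤ L := by
    refine hb.isCompact_closure.induction_on (p := fun s => ∃ L, ∀ x ∈ s ∩ Ω, ‖gradient u x‖ ≤ L)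
      ⟨0, by simp⟩ ?_ ?_ ?_
    · rintro s t hst ⟨L, hL⟩
      exact ⟨L, fun x hx => hL x ⟨hst hx.1, hx.2⟩⟩
    · rintro s t ⟨L, hL⟩ ⟨L', hL'⟩
      refine ⟨max L L', ?_⟩
      rintro x ⟨hx | hx, hxΩ⟩
      · exact (hL x ⟨hx, hxΩ⟩).trans (le_max_left _ _)
      · exact (hL' x ⟨hx, hxΩ⟩).trans (le_max_right _ _)
    · intro x hx
      obtain ⟨s, hs, -, f', hf', hcont⟩ :=
        (contDiffWithinAt_succ_iff_hasFDerivWithinAt (n := 0) (by simp)).mp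
          (by simpa using hu x hx)
      rw [Set.insert_eq_of_mem hx] at hs
      have hev : ∀ᶠ y in nhdsWithin x s, ‖f' y‖ < ‖f' x‖ + 1 :=
        hcont.continuousWithinAt.norm.eventually (gt_mem_nhds (lt_add_one _))
      have hev' : ∀ᶠ y in nhdsWithin x (closure Ω), ‖f' y‖ < ‖f' x‖ + 1 :=
        hev.filter_mono (nhdsWithin_le_of_mem hs)
      obtain ⟨O, hO, hxO, hOs⟩ := mem_nhdsWithin.mp hs
      refine ⟨_, Filter.inter_mem hev' (mem_nhdsWithin_of_mem_nhds (hO.mem_nhds hxO)),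
        ‖f' x‖ + 1, ?_⟩
      rintro y ⟨⟨hy, hyO⟩, hyΩ⟩
      have hys : s ∈ nhds y := Filter.mem_of_superset
        (Filter.inter_mem (hO.mem_nhds hyO) (hΩ.mem_nhds hyΩ))
        fun z hz => hOs ⟨hz.1, subset_closure hz.2⟩
      rw [norm_gradient, ((hf' y (mem_of_mem_nhds hys)).hasFDerivAt hys).fderiv]
      exact le_of_lt hy
  obtain ⟨L, hL⟩ := h
  exact ⟨L, fun x hx => hL x ⟨subset_closure hx, hx⟩⟩

lemma integrableOn_of_continuousOn_of_bounded {f : Plane → ℝ} {C : ℝ} (hΩ : IsOpen Ω)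
    (hb : Bornology.IsBounded Ω) (hf : ContinuousOn f Ω) (hC : ∀ x ∈ Ω, |f x| ≤ C) :
    IntegrableOn f Ω := by
  have : IsFiniteMeasure (volume.restrict Ω) := ⟨by simpa using hb.measure_lt_top⟩
  refine Integrable.of_bound (hf.aestronglyMeasurable hΩ.measurableSet) C ?_
  exact (ae_restrict_iff' hΩ.measurableSet).mpr (Filter.Eventually.of_forall hC)

end gradient

section matrix

lemma inner_matCLM_comm {n : ℕ} {M : Matrix (Fin n) (Fin n) ℝ} (hM : M.IsSymm)
    (ξ ζ : EuclideanSpace ℝ (Fin n)) : ⟪matCLM M ξ, ζ⟫ = ⟪ξ, matCLM M ζ⟫ := by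
  have h : M.IsHermitian := by
    rw [Matrix.IsHermitian, Matrix.conjTranspose_eq_transpose_of_trivial]; exact hM
  exact Matrix.isSymmetric_toEuclideanLin_iff.mpr h ξ ζ

lemma continuous_matCLM {n : ℕ} :
    Continuous (matCLM : Matrix (Fin n) (Fin n) ℝ → _) :=
  ((LinearMap.toContinuousLinearMap.toLinearMap ∘ₗ Matrix.toEuclideanLin.toLinearMap :
    Matrix (Fin n) (Fin n) ℝ →ₗ[ℝ] _)).continuous_of_finiteDimensional

end matrix

section fields

variable {Ω : Set Plane} {p c K : ℝ} {B : Plane → Plane →L[ℝ] Plane} {g : Plane → Plane}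

lemma continuousOn_rpow_inner_form {r : ℝ} (hr : 0 ≤ r) (hB : ContinuousOn B Ω)
    (hg : ContinuousOn g Ω) : ContinuousOn (fun x => ⟪B x (g x), g x⟫ ^ r) Ω :=
  ((hB.clm_apply hg).inner hg).rpow_const fun _ _ => Or.inr hr

lemma continuousOn_flux (hp : 1 < p) (hc : 0 < c) (hB : ContinuousOn B Ω)
    (hell : ∀ x ∈ Ω, ∀ ξ, c * ‖ξ‖ ^ 2 ≤ ⟪B x ξ, ξ⟫) (hK : ∀ x ∈ Ω, ‖B x‖ ≤ K)
    (hg : ContinuousOn g Ω) : ContinuousOn (fun x => flux p (B x) (g x)) Ω := by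
  intro x hx
  rcases eq_or_ne (g x) 0 with h0 | h0
  · have h1 := (continuousOn_rpow_inner_form (r := (p - 1) / 2) (by linarith) hB hg x hx)
    have h2 := h1.const_mul (K / √c)
    simp only [ContinuousWithinAt, h0, flux_zero, inner_zero_right,
      zero_rpow (by linarith : (p - 1) / 2 ≠ 0), mul_zero] at h2 ⊢
    refine squeeze_zero_norm' ?_ h2
    filter_upwards [self_mem_nhdsWithin] with y hy
    exact norm_flux_le hp hc (hell y hy) (hK y hy) (g y)
  · have hBg := hB.clm_apply hg
    have h1 : ContinuousWithinAt (fun x => |⟪B x (g x), g x⟫| ^ ((p - 2) / 2)) Ω x :=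
      ContinuousWithinAt.rpow_const ((hBg.inner hg).abs x hx)
        (Or.inl (abs_ne_zero.mpr (inner_form_pos hc (hell x hx) h0).ne'))
    exact h1.smul (hBg x hx)

lemma inner_form_le_of_norm_le {T : Plane →L[ℝ] Plane} {ξ : Plane} {L : ℝ} (hT : ‖T‖ ≤ K)
    (hξ : ‖ξ‖ ≤ L) : ⟪T ξ, ξ⟫ ≤ K * L * L := by
  have h0 : 0 ≤ L := (norm_nonneg _).trans hξ
  have hK0 : 0 ≤ K := (norm_nonneg _).trans hT
  calc ⟪T ξ, ξ⟫ ≤ ‖T ξ‖ * ‖ξ‖ := real_inner_le_norm _ _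
    _ ≤ ‖T‖ * ‖ξ‖ * ‖ξ‖ := by gcongr; exact T.le_opNorm ξ
    _ ≤ K * L * L := by gcongr

lemma integrableOn_energy_density {σ : Plane → ℝ} {S L : ℝ} (hΩ : IsOpen Ω)
    (hb : Bornology.IsBounded Ω) (hp : 1 < p) (hc : 0 < c) (hB : ContinuousOn B Ω)
    (hell : ∀ x ∈ Ω, ∀ ξ, c * ‖ξ‖ ^ 2 ≤ ⟪B x ξ, ξ⟫) (hK : ∀ x ∈ Ω, ‖B x‖ ≤ K)
    (hσ : ContinuousOn σ Ω) (hS : ∀ x ∈ Ω, ‖σ x‖ ≤ S) (hg : ContinuousOn g Ω)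
    (hL : ∀ x ∈ Ω, ‖g x‖ ≤ L) : IntegrableOn (fun x => σ x * ⟪B x (g x), g x⟫ ^ (p / 2)) Ω := by
  refine integrableOn_of_continuousOn_of_bounded (C := S * (K * L * L) ^ (p / 2)) hΩ hb
    (hσ.mul (continuousOn_rpow_inner_form (by linarith) hB hg)) fun x hx => ?_
  have h0 := inner_form_nonneg hc (hell x hx) (g x)
  have hS0 : 0 ≤ S := (norm_nonneg _).trans (hS x hx)
  rw [abs_mul, abs_of_nonneg (rpow_nonneg h0 _)]
  gcongr
  · exact hS x hx
  · exact inner_form_le_of_norm_le (hK x hx) (hL x hx)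

lemma integrableOn_inner_flux {σ : Plane → ℝ} {S L M : ℝ} {h : Plane → Plane} (hΩ : IsOpen Ω)
    (hb : Bornology.IsBounded Ω) (hp : 1 < p) (hc : 0 < c) (hB : ContinuousOn B Ω)
    (hell : ∀ x ∈ Ω, ∀ ξ, c * ‖ξ‖ ^ 2 ≤ ⟪B x ξ, ξ⟫) (hK : ∀ x ∈ Ω, ‖B x‖ ≤ K)
    (hσ : ContinuousOn σ Ω) (hS : ∀ x ∈ Ω, ‖σ x‖ ≤ S) (hg : ContinuousOn g Ω)
    (hL : ∀ x ∈ Ω, ‖g x‖ ≤ L) (hh : ContinuousOn h Ω) (hM : ∀ x ∈ Ω, ‖h x‖ ≤ M) :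
    IntegrableOn (fun x => σ x * ⟪flux p (B x) (g x), h x⟫) Ω := by
  refine integrableOn_of_continuousOn_of_bounded
    (C := S * (K / √c * (K * L * L) ^ ((p - 1) / 2) * M)) hΩ hb
    (hσ.mul ((continuousOn_flux hp hc hB hell hK hg).inner hh)) fun x hx => ?_
  have h0 := inner_form_nonneg hc (hell x hx) (g x)
  have hS0 : 0 ≤ S := (norm_nonneg _).trans (hS x hx)
  have hK0 : 0 ≤ K := (norm_nonneg _).trans (hK x hx)
  have hL0 : 0 ≤ L := (norm_nonneg _).trans (hL x hx)
  rw [abs_mul]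
  gcongr
  · exact hS x hx
  · refine (abs_real_inner_le_norm _ _).trans ?_
    gcongr
    · refine (norm_flux_le hp hc (hell x hx) (hK x hx) (g x)).trans ?_
      gcongr
      exact inner_form_le_of_norm_le (hK x hx) (hL x hx)
    · exact hM x hx

/-- Two fields whose weighted energies agree coincide if the smaller one satisfies the weak
equation tested against the difference; the weights then agree off the zero set. -/
lemma eq_of_energy_eq {σ₁ σ₂ : Plane → ℝ} {g₁ g₂ : Plane → Plane} {S₁ S₂ L₁ L₂ : ℝ}
    (hΩ : IsOpen Ω) (hb : Bornology.IsBounded Ω) (hp : 1 < p) (hc : 0 < c)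
    (hB : ContinuousOn B Ω) (hsymm : ∀ x ∈ Ω, ∀ ξ ζ, ⟪B x ξ, ζ⟫ = ⟪ξ, B x ζ⟫)
    (hell : ∀ x ∈ Ω, ∀ ξ, c * ‖ξ‖ ^ 2 ≤ ⟪B x ξ, ξ⟫) (hK : ∀ x ∈ Ω, ‖B x‖ ≤ K)
    (hσ₁ : ContinuousOn σ₁ Ω) (hS₁ : ∀ x ∈ Ω, ‖σ₁ x‖ ≤ S₁)
    (hσ₂ : ContinuousOn σ₂ Ω) (hS₂ : ∀ x ∈ Ω, ‖σ₂ x‖ ≤ S₂)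
    (hpos : ∀ x ∈ Ω, 0 < σ₂ x) (hmono : ∀ x ∈ Ω, σ₂ x ≤ σ₁ x)
    (hg₁ : ContinuousOn g₁ Ω) (hL₁ : ∀ x ∈ Ω, ‖g₁ x‖ ≤ L₁)
    (hg₂ : ContinuousOn g₂ Ω) (hL₂ : ∀ x ∈ Ω, ‖g₂ x‖ ≤ L₂)
    (hweak : ∫ x in Ω, σ₂ x * ⟪flux p (B x) (g₂ x), g₁ x - g₂ x⟫ = 0)
    (henergy : ∫ x in Ω, σ₁ x * ⟪B x (g₁ x), g₁ x⟫ ^ (p / 2) =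
      ∫ x in Ω, σ₂ x * ⟪B x (g₂ x), g₂ x⟫ ^ (p / 2)) :
    ∀ x ∈ Ω, g₁ x = g₂ x ∧ (g₂ x ≠ 0 → σ₁ x = σ₂ x) := by
  let e₁ : Plane → ℝ := fun x => σ₁ x * ⟪B x (g₁ x), g₁ x⟫ ^ (p / 2)
  let e₂ : Plane → ℝ := fun x => σ₂ x * ⟪B x (g₂ x), g₂ x⟫ ^ (p / 2)
  let f : Plane → ℝ := fun x => σ₂ x * ⟪flux p (B x) (g₂ x), g₁ x - g₂ x⟫
  have he₁ : IntegrableOn e₁ Ω :=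
    integrableOn_energy_density hΩ hb hp hc hB hell hK hσ₁ hS₁ hg₁ hL₁
  have he₂ : IntegrableOn e₂ Ω :=
    integrableOn_energy_density hΩ hb hp hc hB hell hK hσ₂ hS₂ hg₂ hL₂
  have hf : IntegrableOn f Ω :=
    integrableOn_inner_flux hΩ hb hp hc hB hell hK hσ₂ hS₂ hg₂ hL₂ (hg₁.sub hg₂)
      fun x hx => (norm_sub_le _ _).trans (add_le_add (hL₁ x hx) (hL₂ x hx))
  let R : Plane → ℝ := fun x => e₁ x - e₂ x - p * f x
  have hRcont : ContinuousOn R Ω :=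
    ((hσ₁.mul (continuousOn_rpow_inner_form (by linarith) hB hg₁)).sub
      (hσ₂.mul (continuousOn_rpow_inner_form (by linarith) hB hg₂))).sub
      (continuousOn_const.mul (hσ₂.mul
        ((continuousOn_flux hp hc hB hell hK hg₂).inner (hg₁.sub hg₂))))
  have hRint : IntegrableOn R Ω := (he₁.sub he₂).sub (hf.const_mul p)
  have hRsplit : ∀ x, R x = (σ₁ x - σ₂ x) * ⟪B x (g₁ x), g₁ x⟫ ^ (p / 2) +
      σ₂ x * (⟪B x (g₁ x), g₁ x⟫ ^ (p / 2) -
        (⟪B x (g₂ x), g₂ x⟫ ^ (p / 2) + p * ⟪flux p (B x) (g₂ x), g₁ x - g₂ x⟫)) :=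
    fun x => by simp only [R, e₁, e₂, f]; ring
  have hfirst : ∀ x ∈ Ω, 0 ≤ (σ₁ x - σ₂ x) * ⟪B x (g₁ x), g₁ x⟫ ^ (p / 2) := fun x hx =>
    mul_nonneg (sub_nonneg.mpr (hmono x hx))
      (rpow_nonneg (inner_form_nonneg hc (hell x hx) _) _)
  have hsecond : ∀ x ∈ Ω, g₁ x ≠ g₂ x → 0 < σ₂ x * (⟪B x (g₁ x), g₁ x⟫ ^ (p / 2) -
        (⟪B x (g₂ x), g₂ x⟫ ^ (p / 2) + p * ⟪flux p (B x) (g₂ x), g₁ x - g₂ x⟫)) :=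
    fun x hx hne => mul_pos (hpos x hx)
      (sub_pos.mpr (rpow_inner_form_lt hp hc (hsymm x hx) (hell x hx) hne))
  have hRnonneg : ∀ x ∈ Ω, 0 ≤ R x := by
    intro x hx
    rw [hRsplit]
    refine add_nonneg (hfirst x hx) ?_
    rcases eq_or_ne (g₁ x) (g₂ x) with h | h
    · simp [h]
    · exact (hsecond x hx h).le
  have hRzero : ∫ x in Ω, R x = 0 := by
    have h1 : ∫ x in Ω, R x = (∫ x in Ω, e₁ x) - (∫ x in Ω, e₂ x) - p * ∫ x in Ω, f x := by
      rw [← integral_const_mul, ← integral_sub' he₁ he₂,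
        ← integral_sub (he₁.sub he₂) (hf.const_mul p)]
      rfl
    rw [h1, henergy, hweak]
    simp only [e₂]; ring
  have hRae := (setIntegral_eq_zero_iff_of_nonneg_ae
    ((ae_restrict_iff' hΩ.measurableSet).mpr (Filter.Eventually.of_forall hRnonneg)) hRint).mp
    hRzero
  have hReq := Measure.eqOn_open_of_ae_eq hRae hΩ hRcont continuousOn_const
  intro x hx
  have h0 : R x = 0 := hReq hx
  rw [hRsplit] at h0
  have hg : g₁ x = g₂ x := by
    by_contra hne
    linarith [hfirst x hx, hsecond x hx hne]
  refine ⟨hg, fun hne => ?_⟩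
  have h1 := rpow_pos_of_pos (inner_form_pos hc (hell x hx) hne) (p / 2)
  have h2 : (σ₁ x - σ₂ x) * ⟪B x (g₂ x), g₂ x⟫ ^ (p / 2) = 0 := by
    simpa [hg] using h0
  have := (mul_eq_zero.mp h2).resolve_right h1.ne'
  linarith

end fields

/-- The covector `F₀ dx₁ - F₁ dx₀` obtained by rotating a planar vector. -/
noncomputable def rotCovector : Plane →L[ℝ] Plane →L[ℝ] ℝ :=
  (EuclideanSpace.proj 0 : Plane →L[ℝ] ℝ).smulRight (EuclideanSpace.proj 1 : Plane →L[ℝ] ℝ) -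
    (EuclideanSpace.proj 1 : Plane →L[ℝ] ℝ).smulRight (EuclideanSpace.proj 0 : Plane →L[ℝ] ℝ)

lemma wedge_rotCovector (L : Plane →L[ℝ] ℝ) (F : Plane) : wedge L (rotCovector F) = L F := by
  have hF : F = F 0 • EuclideanSpace.single 0 1 + F 1 • EuclideanSpace.single 1 1 := by
    ext i; fin_cases i <;> simp
  conv_rhs => rw [hF]
  simp [wedge, rotCovector]
  ring

lemma exists_contDiff_eqOn_ball {f : Plane → ℝ} {x₀ : Plane} {r : ℝ} (hr : 0 < r)
    (hf : ContDiffOn ℝ 1 f (Metric.ball x₀ r)) :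
    ∃ g : Plane → ℝ, ContDiff ℝ 1 g ∧ Set.EqOn g f (Metric.ball x₀ (r / 2)) := by
  let χ : ContDiffBump x₀ := ⟨r / 2, 3 * r / 4, by linarith, by linarith⟩
  refine ⟨fun x => χ x * f x, contDiff_iff_contDiffAt.mpr fun x => ?_, fun x hx => ?_⟩
  · by_cases hx : x ∈ Metric.ball x₀ r
    · exact χ.contDiff.contDiffAt.mul (hf.contDiffAt (Metric.isOpen_ball.mem_nhds hx))
    · have h1 : x ∉ tsupport χ := by
        rw [χ.tsupport_eq]
        exact fun h => hx (Metric.closedBall_subset_ball (by simp only [χ]; linarith) h)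
      refine contDiffAt_const (c := (0 : ℝ)) |>.congr_of_eventuallyEq ?_
      filter_upwards [notMem_tsupport_iff_eventuallyEq.mp h1] with z hz
      simp [hz]
  · have : χ x = 1 := χ.one_of_mem_closedBall (Metric.ball_subset_closedBall hx)
    simp [this]

/-- A weakly divergence-free continuous planar field locally has a conjugate function. -/
lemma exists_conjugate {Ω : Set Plane} {F : Plane → Plane} {x₀ : Plane} (hΩ : IsOpen Ω)
    (hx₀ : x₀ ∈ Ω) (hF : ContinuousOn F Ω)
    (hdiv : ∀ φ : Plane → ℝ, ContDiff ℝ 1 φ → tsupport φ ⊆ Ω →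
      ∫ x in Ω, ⟪F x, gradient φ x⟫ = 0) :
    ∃ r > 0, Metric.ball x₀ r ⊆ Ω ∧
      ∃ v : Plane → ℝ, ∀ x ∈ Metric.ball x₀ r, HasFDerivAt v (rotCovector (F x)) x := by
  obtain ⟨s, hs, hsub⟩ := Metric.isOpen_iff.mp hΩ x₀ hx₀
  let χ : ContDiffBump x₀ := ⟨s / 3, s / 2, by linarith, by linarith⟩
  have hone : ∀ x ∈ Metric.ball x₀ (s / 3), χ x = 1 := fun x hx =>
    χ.one_of_mem_closedBall (Metric.ball_subset_closedBall hx)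
  let G : Plane → Plane →L[ℝ] ℝ := fun x => χ x • rotCovector (F x)
  have hsupp : tsupport G ⊆ tsupport χ := tsupport_smul_subset_left _ _
  have hGΩ : tsupport G ⊆ Ω := by
    refine hsupp.trans ?_
    rw [χ.tsupport_eq]
    exact (Metric.closedBall_subset_ball (by simp only [χ]; linarith)).trans hsub
  have hGcont : Continuous G :=
    (χ.continuous.continuousOn.smul
      (rotCovector.continuous.comp_continuousOn hF)).continuous_of_tsupport_subset hΩ hGΩ
  have hGc : HasCompactSupport G := χ.hasCompactSupport.mono' (subset_closure.trans hsupp)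
  have h3 : Metric.ball x₀ (s / 3) ⊆ Ω := (Metric.ball_subset_ball (by linarith)).trans hsub
  obtain ⟨v, hv⟩ := exists_primitive_of_weakly_closed hGcont hGc (by linarith : 0 < s / 3)
    (x₀ := x₀) (by
      intro φ hφ hφs
      have hzero : ∀ x, x ∉ Metric.ball x₀ (s / 3) → fderiv ℝ φ x = 0 := fun x hx =>
        image_eq_zero_of_notMem_tsupport fun h => hx (hφs (tsupport_fderiv_subset ℝ h))
      rw [← hdiv φ hφ (hφs.trans h3), setIntegral_eq_integral_of_forall_compl_eq_zero]
      · refine integral_congr_ae (Filter.Eventually.of_forall fun x => ?_)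
        simp only
        rw [real_inner_comm, inner_gradient_left]
        by_cases hx : x ∈ Metric.ball x₀ (s / 3)
        · simp only [G, hone x hx, one_smul, wedge_rotCovector]
        · simp [hzero x hx, wedge]
      · intro x hx
        rw [real_inner_comm, inner_gradient_left, hzero x fun h => hx (h3 h)]
        simp)
  refine ⟨s / 3 / 2, by linarith, (Metric.ball_subset_ball (by linarith)).trans h3, v,
    fun x hx => ?_⟩
  have := hv x hx
  rwa [show G x = rotCovector (F x) by
    simp only [G, hone x (Metric.ball_subset_ball (by linarith) hx), one_smul]] at this

lemma exists_flux_coercive {p q c S K N : ℝ} (hpq : p.HolderConjugate q) (hc : 0 < c)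
    (hS : 0 ≤ S) (hK : 0 ≤ K) (hN : 0 ≤ N) :
    ∃ κ > 0, ∀ (B : Plane →L[ℝ] Plane) (σ : ℝ) (ξ : Plane) (ν : ℝ),
      (∀ ξ, c * ‖ξ‖ ^ 2 ≤ ⟪B ξ, ξ⟫) → ‖B‖ ≤ K → c ≤ σ → σ ≤ S → 0 ≤ ν →
      ν ≤ N * ‖σ • flux p B ξ‖ → κ * (‖ξ‖ ^ p + ν ^ q) ≤ σ * ⟪flux p B ξ, ξ⟫ := by
  have hp := hpq.lt
  have hq := hpq.symm.lt
  set C := N * (S * (K / √c)) + 1 with hC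
  have hC0 : 0 < C := by positivity
  have h1 : 0 < c ^ (p / 2) := rpow_pos_of_pos hc _
  have h2 : 0 < C ^ q := rpow_pos_of_pos hC0 _
  refine ⟨c / 2 * min (c ^ (p / 2)) (C ^ q)⁻¹, by positivity, ?_⟩
  intro B σ ξ ν hell hB hσ hσS hν0 hν
  rw [inner_flux_self hp hc hell]
  have hQ := inner_form_nonneg hc hell ξ
  have hQp : 0 ≤ ⟪B ξ, ξ⟫ ^ (p / 2) := rpow_nonneg hQ _
  have ha : c ^ (p / 2) * ‖ξ‖ ^ p ≤ ⟪B ξ, ξ⟫ ^ (p / 2) := by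
    have h3 : ‖ξ‖ ^ p = (‖ξ‖ ^ 2) ^ (p / 2) := by
      rw [← rpow_natCast, ← rpow_mul (norm_nonneg _)]
      congr 1; push_cast; ring
    rw [h3, ← mul_rpow hc.le (by positivity)]
    exact rpow_le_rpow (by positivity) (hell ξ) (by linarith)
  have hb : (C ^ q)⁻¹ * ν ^ q ≤ ⟪B ξ, ξ⟫ ^ (p / 2) := by
    rw [inv_mul_le_iff₀ h2]
    have h3 : ⟪B ξ, ξ⟫ ^ (p / 2) = (⟪B ξ, ξ⟫ ^ ((p - 1) / 2)) ^ q := by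
      rw [← rpow_mul hQ]
      congr 1
      have := hpq.sub_one_mul_conj
      linarith
    have hR : 0 ≤ ⟪B ξ, ξ⟫ ^ ((p - 1) / 2) := rpow_nonneg hQ _
    rw [h3, ← mul_rpow hC0.le hR]
    refine rpow_le_rpow hν0 ?_ (by linarith)
    have h4 := norm_flux_le hp hc hell hB ξ
    have h5 : |σ| ≤ S := by rw [abs_of_pos (hc.trans_le hσ)]; exact hσS
    calc ν ≤ N * ‖σ • flux p B ξ‖ := hν
      _ ≤ N * (S * (K / √c * ⟪B ξ, ξ⟫ ^ ((p - 1) / 2))) := by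
        rw [norm_smul, Real.norm_eq_abs]; gcongr
      _ ≤ C * ⟪B ξ, ξ⟫ ^ ((p - 1) / 2) := by rw [hC]; nlinarith
  have hξ0 : 0 ≤ ‖ξ‖ ^ p := by positivity
  have hνq : 0 ≤ ν ^ q := rpow_nonneg hν0 _
  calc _ ≤ c / 2 * (c ^ (p / 2) * ‖ξ‖ ^ p + (C ^ q)⁻¹ * ν ^ q) := by
        rw [mul_assoc, mul_add]
        gcongr
        · exact min_le_left _ _
        · exact min_le_right _ _
    _ ≤ c / 2 * (⟪B ξ, ξ⟫ ^ (p / 2) + ⟪B ξ, ξ⟫ ^ (p / 2)) := by gcongr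
    _ = c * ⟪B ξ, ξ⟫ ^ (p / 2) := by ring
    _ ≤ σ * ⟪B ξ, ξ⟫ ^ (p / 2) := by gcongr

lemma eqOn_const_of_fderiv_eq_zero {f : Plane → ℝ} (hf : ContDiff ℝ 1 f) {y : Plane} {δ : ℝ}
    (hδ : 0 < δ) (h : ∀ x ∈ Metric.ball y δ, fderiv ℝ f x = 0) :
    ∀ x ∈ Metric.ball y δ, f x = f y := fun _ hx =>
  Metric.isOpen_ball.is_const_of_fderiv_eq_zero (convex_ball y δ).isPreconnected
    (hf.differentiable one_ne_zero).differentiableOn h hx (Metric.mem_ball_self hδ)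

/-- The interior of the critical set of a solution is relatively closed. -/
lemma gradient_eventually_eq_zero {Ω : Set Plane} {p c S K : ℝ} {σ : Plane → ℝ}
    {B : Plane → Plane →L[ℝ] Plane} {u : Plane → ℝ} {x₀ : Plane} (hΩ : IsOpen Ω) (hp : 1 < p)
    (hc : 0 < c) (hB : ContinuousOn B Ω) (hell : ∀ x ∈ Ω, ∀ ξ, c * ‖ξ‖ ^ 2 ≤ ⟪B x ξ, ξ⟫)
    (hK : ∀ x ∈ Ω, ‖B x‖ ≤ K) (hσ : ContinuousOn σ Ω) (hσc : ∀ x ∈ Ω, c ≤ σ x)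
    (hσS : ∀ x ∈ Ω, σ x ≤ S) (hu : ContDiffOn ℝ 1 u Ω)
    (hdiv : ∀ φ : Plane → ℝ, ContDiff ℝ 1 φ → tsupport φ ⊆ Ω →
      ∫ x in Ω, ⟪σ x • flux p (B x) (gradient u x), gradient φ x⟫ = 0)
    (hx₀ : x₀ ∈ Ω) (hcl : x₀ ∈ closure {x | ∀ᶠ y in nhds x, gradient u y = 0}) :
    ∀ᶠ y in nhds x₀, gradient u y = 0 := by
  have hpq := Real.HolderConjugate.conjExponent hp
  set q := p.conjExponent
  have hq := hpq.symm.lt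
  have hgrad : ContinuousOn (gradient u) Ω := (LinearIsometryEquiv.continuous _).comp_continuousOn
    (hu.continuousOn_fderiv_of_isOpen hΩ le_rfl)
  set F : Plane → Plane := fun x => σ x • flux p (B x) (gradient u x) with hFdef
  have hF : ContinuousOn F Ω := hσ.smul (continuousOn_flux hp hc hB hell hK hgrad)
  obtain ⟨r, hr, hrΩ, v, hv⟩ := exists_conjugate hΩ hx₀ hF hdiv
  have hvC1 : ContDiffOn ℝ 1 v (Metric.ball x₀ r) := by
    rw [← zero_add 1, contDiffOn_succ_iff_fderiv_of_isOpen Metric.isOpen_ball]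
    refine ⟨fun x hx => (hv x hx).differentiableAt.differentiableWithinAt, by simp,
      contDiffOn_zero.mpr ?_⟩
    exact (rotCovector.continuous.comp_continuousOn (hF.mono hrΩ)).congr
      fun x hx => (hv x hx).fderiv
  obtain ⟨U, hU, hUu⟩ := exists_contDiff_eqOn_ball hr (hu.mono hrΩ)
  obtain ⟨V, hV, hVv⟩ := exists_contDiff_eqOn_ball hr hvC1
  have hrr : Metric.ball x₀ (r / 2) ⊆ Metric.ball x₀ r := Metric.ball_subset_ball (by linarith)
  have hdU : ∀ x ∈ Metric.ball x₀ (r / 2), fderiv ℝ U x = fderiv ℝ u x := fun x hx =>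
    (hUu.eventuallyEq_of_mem (Metric.isOpen_ball.mem_nhds hx)).fderiv_eq
  have hdV : ∀ x ∈ Metric.ball x₀ (r / 2), fderiv ℝ V x = rotCovector (F x) := fun x hx =>
    (hVv.eventuallyEq_of_mem (Metric.isOpen_ball.mem_nhds hx)).fderiv_eq.trans
      (hv x (hrr hx)).fderiv
  set ε := exp (-2) with hε
  have hε0 : 0 < ε := exp_pos _
  have hε1 : ε ≤ 1 := by rw [hε, exp_le_one_iff]; norm_num
  have hnear : ∀ᶠ x in nhds x₀, dist (U x) (U x₀) < ε / 2 ∧ dist (V x) (V x₀) < ε / 2 :=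
    (Metric.tendsto_nhds.mp hU.continuous.continuousAt _ (half_pos hε0)).and
      (Metric.tendsto_nhds.mp hV.continuous.continuousAt _ (half_pos hε0))
  obtain ⟨R₀, hR₀, hball⟩ := Metric.eventually_nhds_iff_ball.mp hnear
  set R := min R₀ (r / 2) with hRdef
  have hR : 0 < R := lt_min hR₀ (half_pos hr)
  have hRr : Metric.ball x₀ R ⊆ Metric.ball x₀ (r / 2) :=
    Metric.ball_subset_ball (min_le_right _ _)
  have hRhalf : Metric.ball x₀ (R / 2) ⊆ Metric.ball x₀ R := Metric.ball_subset_ball (by linarith)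
  obtain ⟨y, hyR, hyS⟩ := mem_closure_iff.mp hcl _ Metric.isOpen_ball
    (Metric.mem_ball_self (half_pos hR))
  obtain ⟨δ, hδ, hyδ⟩ := Metric.eventually_nhds_iff_ball.mp
    (hyS.and (Metric.isOpen_ball.eventually_mem hyR))
  have hysub : Metric.ball y δ ⊆ Metric.ball x₀ (R / 2) := fun z hz => (hyδ z hz).2
  have hyU : ∀ x ∈ Metric.ball y δ, U x = U y :=
    eqOn_const_of_fderiv_eq_zero hU hδ fun x hx => by
      rw [hdU x (hRr (hRhalf (hysub hx))), ← norm_eq_zero, ← norm_gradient, (hyδ x hx).1, norm_zero]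
  have hyV : ∀ x ∈ Metric.ball y δ, V x = V y :=
    eqOn_const_of_fderiv_eq_zero hV hδ fun x hx => by
      rw [hdV x (hRr (hRhalf (hysub hx)))]
      simp only [hFdef, (hyδ x hx).1, flux_zero, smul_zero, map_zero]
  have hK0 : 0 ≤ K := (norm_nonneg _).trans (hK x₀ hx₀)
  have hS0 : 0 ≤ S := hc.le.trans ((hσc x₀ hx₀).trans (hσS x₀ hx₀))
  obtain ⟨κ, hκ, hcoer⟩ := exists_flux_coercive hpq hc hS0 hK0 (norm_nonneg rotCovector)
  have hzero := eq_zero_of_wedge_coercive (u := fun x => U x - U y) (v := fun x => V x - V y)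
    (x₀ := x₀) hpq (hU.sub contDiff_const) (hV.sub contDiff_const) hκ hR
    (by
      intro x hx
      have hxr := hRr hx
      have hxΩ : x ∈ Ω := hrΩ (hrr hxr)
      rw [fderiv_sub_const, fderiv_sub_const, hdU x hxr, hdV x hxr, wedge_rotCovector,
        ← inner_gradient_left, real_inner_comm, ← norm_gradient, real_inner_smul_left]
      exact hcoer (B x) (σ x) (gradient u x) _ (hell x hxΩ) (hK x hxΩ) (hσc x hxΩ) (hσS x hxΩ)
        (norm_nonneg _) (rotCovector.le_opNorm _))
    (by
      intro x hx
      have hsmall : ∀ {t s : ℝ}, |t| ≤ ε → 1 < s → |t| ^ s ≤ ε := fun {t s} ht hs => by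
        refine (rpow_le_rpow_of_exponent_ge_of_imp (abs_nonneg t) (ht.trans hε1) hs.le
          fun _ h => by linarith).trans ?_
        rwa [rpow_one]
      have hclose : ∀ {W : Plane → ℝ}, dist (W x) (W x₀) < ε / 2 → dist (W y) (W x₀) < ε / 2 →
          |W x - W y| ≤ ε := fun {W} h1 h2 => by
        rw [← Real.dist_eq]
        linarith [dist_triangle_right (W x) (W y) (W x₀)]
      obtain ⟨hx1, hx2⟩ := hball x (Metric.ball_subset_ball (min_le_left _ _) hx)
      obtain ⟨hy1, hy2⟩ := hball y (Metric.ball_subset_ball (min_le_left _ _) (hRhalf hyR))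
      have h1 := hsmall (hclose hx1 hy1) hp
      have h2 := hsmall (hclose hx2 hy2) hq
      have h3 : exp (-1) = exp 1 * ε := by rw [hε, ← exp_add]; norm_num
      have h4 := Real.add_one_le_exp 1
      nlinarith)
    hδ hysub fun x hx => ⟨sub_eq_zero.mpr (hyU x hx), sub_eq_zero.mpr (hyV x hx)⟩
  filter_upwards [Metric.isOpen_ball.mem_nhds (Metric.mem_ball_self (x := x₀) (half_pos hR))]
    with x hx
  have hloc : U =ᶠ[nhds x] fun _ => U y := by
    filter_upwards [Metric.isOpen_ball.mem_nhds hx] with z hz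
    exact sub_eq_zero.mp (hzero z hz).1
  rw [← norm_eq_zero, norm_gradient, ← hdU x (hRr (hRhalf hx)), hloc.fderiv_eq]
  simp

/-- **Theorem 1.1 / 2.1** (interior uniqueness in the plane): if `σ₁ ≥ σ₂` are
Lipschitz conductivities on a bounded connected planar domain, `u₂` is a
non-constant weak solution for `σ₂`, and `u₁` is a weak solution for `σ₁` with
the same boundary values and the same energy (as happens when the nonlinear
DN maps coincide), then `σ₁ = σ₂` in `Ω`. -/
theorem interior_uniqueness_2d
    (Ω : Set (EuclideanSpace ℝ (Fin 2)))
    (hΩopen : IsOpen Ω) (hΩbdd : Bornology.IsBounded Ω) (hΩconn : IsConnected Ω)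
    (p : ℝ) (hp1 : 1 < p) (c₀ : ℝ) (hc₀ : 0 < c₀)
    (σ₁ σ₂ : EuclideanSpace ℝ (Fin 2) → ℝ)
    (hσ₁lip : ∃ K : NNReal, LipschitzOnWith K σ₁ (closure Ω))
    (hσ₂lip : ∃ K : NNReal, LipschitzOnWith K σ₂ (closure Ω))
    (hσ₁pos : ∀ x ∈ Ω, c₀ ≤ σ₁ x) (hσ₂pos : ∀ x ∈ Ω, c₀ ≤ σ₂ x)
    (A : EuclideanSpace ℝ (Fin 2) → Matrix (Fin 2) (Fin 2) ℝ)
    (hAlip : ∃ K : NNReal, ∀ i j : Fin 2,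
      LipschitzOnWith K (fun x => A x i j) (closure Ω))
    (hAsymm : ∀ x ∈ Ω, (A x).IsSymm)
    (hAell : ∀ x ∈ Ω, ∀ ξ : EuclideanSpace ℝ (Fin 2),
      c₀ * ‖ξ‖ ^ 2 ≤ ⟪matCLM (A x) ξ, ξ⟫)
    (hmono : ∀ x ∈ Ω, σ₂ x ≤ σ₁ x)
    (u₁ u₂ : EuclideanSpace ℝ (Fin 2) → ℝ)
    (hu₁C1 : ContDiffOn ℝ 1 u₁ (closure Ω)) (hu₂C1 : ContDiffOn ℝ 1 u₂ (closure Ω))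
    (hu₂nonconst : ¬ ∃ c : ℝ, ∀ x ∈ closure Ω, u₂ x = c)
    (hu₂sol : IsWeakSolution Ω p σ₂ A u₂)
    (hu₁sol : IsWeakSolution Ω p σ₁ A u₁)
    (hbdry : ∀ x ∈ frontier Ω, u₁ x = u₂ x)
    (henergy : energy Ω p σ₁ A u₁ = energy Ω p σ₂ A u₂) :
    ∀ x ∈ Ω, σ₁ x = σ₂ x := by
  obtain ⟨K₁, hK₁⟩ := hσ₁lip
  obtain ⟨K₂, hK₂⟩ := hσ₂lip
  obtain ⟨KA, hKA⟩ := hAlip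
  have hcpt := hΩbdd.isCompact_closure
  have hsub : Ω ⊆ closure Ω := subset_closure
  set B : Plane → Plane →L[ℝ] Plane := fun x => matCLM (A x)
  have hBcl : ContinuousOn B (closure Ω) := continuous_matCLM.comp_continuousOn
    (continuousOn_pi.mpr fun i => continuousOn_pi.mpr fun j => (hKA i j).continuousOn)
  have hB : ContinuousOn B Ω := hBcl.mono hsub
  have hσ₁ : ContinuousOn σ₁ Ω := hK₁.continuousOn.mono hsub
  have hσ₂ : ContinuousOn σ₂ Ω := hK₂.continuousOn.mono hsub
  obtain ⟨K, hK⟩ := hcpt.exists_bound_of_continuousOn hBcl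
  obtain ⟨S₁, hS₁⟩ := hcpt.exists_bound_of_continuousOn hK₁.continuousOn
  obtain ⟨S₂, hS₂⟩ := hcpt.exists_bound_of_continuousOn hK₂.continuousOn
  obtain ⟨L₁, hL₁⟩ := exists_norm_gradient_le hΩopen hΩbdd hu₁C1
  obtain ⟨L₂, hL₂⟩ := exists_norm_gradient_le hΩopen hΩbdd hu₂C1
  have habs : ∀ x ∈ Ω, ∀ ξ, |⟪B x ξ, ξ⟫| = ⟪B x ξ, ξ⟫ := fun x hx ξ =>
    abs_of_nonneg (inner_form_nonneg hc₀ (hAell x hx) ξ)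
  have hweak : ∫ x in Ω, σ₂ x *
      ⟪flux p (B x) (gradient u₂ x), gradient u₁ x - gradient u₂ x⟫ = 0 := by
    rw [← hu₂sol (u₁ - u₂) (hu₁C1.sub hu₂C1) fun x hx => sub_eq_zero.mpr (hbdry x hx)]
    refine setIntegral_congr_fun hΩopen.measurableSet fun x hx => ?_
    have hgrad : gradient (u₁ - u₂) x = gradient u₁ x - gradient u₂ x := by
      rw [gradient, fderiv_sub (differentiableAt_of_contDiffOn_closure hΩopen hu₁C1 hx)
        (differentiableAt_of_contDiffOn_closure hΩopen hu₂C1 hx), map_sub]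
      rfl
    simp only [hgrad, flux, real_inner_smul_left, B, mul_assoc]
  have hdiv : ∀ φ : Plane → ℝ, ContDiff ℝ 1 φ → tsupport φ ⊆ Ω →
      ∫ x in Ω, ⟪σ₂ x • flux p (B x) (gradient u₂ x), gradient φ x⟫ = 0 := by
    intro φ hφ hφΩ
    rw [← hu₂sol φ hφ.contDiffOn fun x hx => image_eq_zero_of_notMem_tsupport fun h =>
      (hΩopen.frontier_eq ▸ hx).2 (hφΩ h)]
    simp only [flux, real_inner_smul_left, B, mul_assoc]
  have hene : ∫ x in Ω, σ₁ x * ⟪B x (gradient u₁ x), gradient u₁ x⟫ ^ (p / 2) =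
      ∫ x in Ω, σ₂ x * ⟪B x (gradient u₂ x), gradient u₂ x⟫ ^ (p / 2) := by
    refine Eq.trans ?_ (henergy.trans ?_) <;>
      refine setIntegral_congr_fun hΩopen.measurableSet fun x hx => ?_
    · exact congrArg (fun t => σ₁ x * t ^ (p / 2)) (habs x hx _).symm
    · exact congrArg (fun t => σ₂ x * t ^ (p / 2)) (habs x hx _)
  have hnoncrit := fun x hx => (eq_of_energy_eq hΩopen hΩbdd hp1 hc₀ hB
    (fun x hx => inner_matCLM_comm (hAsymm x hx)) hAell (fun x hx => hK x (hsub hx))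
    hσ₁ (fun x hx => hS₁ x (hsub hx)) hσ₂ (fun x hx => hS₂ x (hsub hx))
    (fun x hx => hc₀.trans_le (hσ₂pos x hx)) hmono
    (continuousOn_gradient hΩopen hu₁C1) hL₁ (continuousOn_gradient hΩopen hu₂C1) hL₂
    hweak hene x hx).2
  set Z : Set Plane := {x | ∀ᶠ y in nhds x, gradient u₂ y = 0}
  have hZ : ¬ (Ω ∩ Z).Nonempty := by
    intro hne
    have hΩZ : Ω ⊆ Z := hΩconn.isPreconnected.subset_of_closure_inter_subset
      isOpen_setOfPred_eventually_nhds hne fun x hx =>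
        gradient_eventually_eq_zero hΩopen hp1 hc₀ hB hAell (fun x hx => hK x (hsub hx)) hσ₂
          hσ₂pos (fun x hx => (le_abs_self _).trans (hS₂ x (hsub hx))) (hu₂C1.mono hsub) hdiv
          hx.2 hx.1
    obtain ⟨x₀, hx₀⟩ := hΩconn.nonempty
    have hconst : Set.EqOn u₂ (fun _ => u₂ x₀) Ω := fun x hx =>
      hΩopen.is_const_of_fderiv_eq_zero hΩconn.isPreconnected
        ((hu₂C1.mono hsub).differentiableOn one_ne_zero)
        (fun z hz => by
          rw [Pi.zero_apply, ← norm_eq_zero, ← norm_gradient, (hΩZ hz).self_of_nhds, norm_zero])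
        hx hx₀
    exact hu₂nonconst ⟨u₂ x₀,
      hconst.of_subset_closure hu₂C1.continuousOn continuousOn_const hsub subset_rfl⟩
  have heq : Set.EqOn σ₁ σ₂ {x ∈ Ω | gradient u₂ x ≠ 0} := fun x hx => hnoncrit x hx.1 hx.2
  refine heq.of_subset_closure hσ₁ hσ₂ (Set.sep_subset _ _) fun x hx => ?_
  have hfreq : ∃ᶠ y in nhds x, gradient u₂ y ≠ 0 := fun h =>
    hZ ⟨x, hx, h.mono fun _ hy => not_not.mp hy⟩
  exact mem_closure_iff_frequently.mpr
    ((hfreq.and_eventually (hΩopen.mem_nhds hx)).mono fun y hy => ⟨hy.2, hy.1⟩)
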